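/- Let L ≥ 2 and n₀, n_L be fixed, consider rectangular (L,w)-DLNs, and let θ have i.i.d. N(0, w^{−γ}) entries with 1 − 1/L ≤ γ < 1. Suppose the set of matrices minimizing C is nonempty, has Lebesgue measure zero in ℝ^{n_L×n₀}, and does not contain the zero matrix. Then, as w → ∞, d_m ≍ w^{−(1−γ)(L−1)/2} and d_s ≍ w^{(1−γ)/2}. -/

import Mathlib

open MeasureTheory ProbabilityTheory

noncomputable section

/-- Index set for the parameters of a rectangular `(L,w)`-DLN with input dimension `n0`
and output dimension `nL`: entries of `W₁ ∈ ℝ^{w×n0}`, of the `L-2` hidden matrices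
`W₂,…,W_{L-1} ∈ ℝ^{w×w}`, and of `W_L ∈ ℝ^{nL×w}`. -/
abbrev DLNIdx (n0 nL w L : ℕ) :=
  (Fin w × Fin n0) ⊕ (Fin (L - 2) × Fin w × Fin w) ⊕ (Fin nL × Fin w)

/-- The (Euclidean) parameter space of a rectangular `(L,w)`-DLN, as a plain pi type. -/
abbrev DLNParams (n0 nL w L : ℕ) := DLNIdx n0 nL w L → ℝ

variable {n0 nL w L : ℕ}

/-- The first weight matrix `W₁`. -/
def dlnW1 (θ : DLNParams n0 nL w L) : Matrix (Fin w) (Fin n0) ℝ :=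
  Matrix.of fun i j => θ (Sum.inl (i, j))

/-- The hidden weight matrices `W₂, …, W_{L-1}` (`dlnWmid θ ℓ = W_{ℓ+2}`). -/
def dlnWmid (θ : DLNParams n0 nL w L) (ℓ : Fin (L - 2)) : Matrix (Fin w) (Fin w) ℝ :=
  Matrix.of fun i j => θ (Sum.inr (Sum.inl (ℓ, i, j)))

/-- The last weight matrix `W_L`. -/
def dlnWL (θ : DLNParams n0 nL w L) : Matrix (Fin nL) (Fin w) ℝ :=
  Matrix.of fun i j => θ (Sum.inr (Sum.inr (i, j)))

/-- The matrix `A_θ = W_L ⋯ W₁` realized by the network, as a function. -/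
def dlnMatrix (θ : DLNParams n0 nL w L) : Fin nL → Fin n0 → ℝ :=
  fun i j => (dlnWL θ * (List.ofFn (dlnWmid θ)).reverse.prod * dlnW1 θ) i j

/-- The loss `𝓛(θ) = C(A_θ)`. -/
def dlnLoss (C : (Fin nL → Fin n0 → ℝ) → ℝ) (θ : DLNParams n0 nL w L) : ℝ :=
  C (dlnMatrix θ)

/-- Euclidean distance between two parameter vectors. -/
def dlnDist (θ θ' : DLNParams n0 nL w L) : ℝ :=
  Real.sqrt (∑ i, (θ i - θ' i) ^ 2)

/-- `θ` is a global minimum of `𝓛`, i.e. `C (A_θ) = inf C`. -/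
def DLNIsGlobalMin (C : (Fin nL → Fin n0 → ℝ) → ℝ) (θ : DLNParams n0 nL w L) : Prop :=
  ∀ A, C (dlnMatrix θ) ≤ C A

/-- `θ` is a saddle of `𝓛`: a critical point at which `𝓛` has no local minimum. -/
def DLNIsSaddle (C : (Fin nL → Fin n0 → ℝ) → ℝ) (θ : DLNParams n0 nL w L) : Prop :=
  fderiv ℝ (dlnLoss C) θ = 0 ∧ ¬ IsLocalMin (dlnLoss C) θ

/-- `d_m`: Euclidean distance from `θ` to the set of global minima of `𝓛`. -/
def dlnDm (C : (Fin nL → Fin n0 → ℝ) → ℝ) (θ : DLNParams n0 nL w L) : ℝ :=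
  sInf ((fun θ' => dlnDist θ θ') '' {θ' | DLNIsGlobalMin C θ'})

/-- `d_s`: Euclidean distance from `θ` to the set of saddles of `𝓛`. -/
def dlnDs (C : (Fin nL → Fin n0 → ℝ) → ℝ) (θ : DLNParams n0 nL w L) : ℝ :=
  sInf ((fun θ' => dlnDist θ θ') '' {θ' | DLNIsSaddle C θ'})

/-- The law of a parameter vector with i.i.d. centered Gaussian `N(0, σ²)` entries. -/
def dlnGauss (n0 nL w L : ℕ) (σ2 : ℝ) : Measure (DLNParams n0 nL w L) :=
  Measure.pi fun _ => gaussianReal 0 (Real.toNNReal σ2)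

lemma aux_gauss_lin {ι : Type*} [Fintype ι] (v : NNReal) (a : ι → ℝ) :
    (Measure.pi fun _ : ι => gaussianReal 0 v).map (fun θ => ∑ i, a i * θ i)
      = gaussianReal 0 (Real.toNNReal (∑ i, a i ^ 2) * v) := by
  have hm : Measurable (fun θ : ι → ℝ => ∑ i, a i * θ i) := by fun_prop
  have : IsProbabilityMeasure ((Measure.pi fun _ : ι => gaussianReal 0 v).map
    (fun θ => ∑ i, a i * θ i)) := Measure.isProbabilityMeasure_map hm.aemeasurable
  apply Measure.ext_of_charFun
  funext t
  rw [charFun_apply_real, integral_map hm.aemeasurable (by fun_prop)]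
  have h1 : ∀ θ : ι → ℝ, Complex.exp (t * ((∑ i, a i * θ i : ℝ) : ℂ) * Complex.I)
      = ∏ i, Complex.exp (((t * a i : ℝ) : ℂ) * (θ i : ℂ) * Complex.I) := by
    intro θ
    rw [← Complex.exp_sum]
    congr 1
    push_cast
    rw [Finset.mul_sum, Finset.sum_mul]
    refine Finset.sum_congr rfl fun i _ => by ring
  simp_rw [h1]
  rw [integral_fintype_prod_eq_prod (𝕜 := ℂ)
    (f := fun i (x : ℝ) => Complex.exp (((t * a i : ℝ) : ℂ) * (x : ℂ) * Complex.I))]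
  simp_rw [← charFun_apply_real, charFun_gaussianReal]
  rw [← Complex.exp_sum]
  congr 1
  have : ((Real.toNNReal (∑ i, a i ^ 2) * v : NNReal) : ℝ) = (∑ i, a i ^ 2) * v := by
    rw [NNReal.coe_mul, Real.coe_toNNReal _ (Finset.sum_nonneg fun i _ => sq_nonneg _)]
  rw [show (((Real.toNNReal (∑ i, a i ^ 2) * v : NNReal) : ℝ) : ℂ)
    = (((∑ i, a i ^ 2) * v : ℝ) : ℂ) by rw [this]]
  push_cast
  simp only [mul_zero, zero_mul, zero_sub]
  rw [Finset.sum_neg_distrib]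
  congr 1
  rw [Finset.sum_mul, Finset.sum_mul, Finset.sum_div]
  refine Finset.sum_congr rfl fun i _ => by ring

/-- overwrite coordinates along an injection -/
def auxOver {ι κ : Type*} (e : κ → ι) (θ : ι → ℝ) (ξ : κ → ℝ) : ι → ℝ :=
  Function.extend e ξ θ

lemma aux_resample_map {ι κ : Type*} [Fintype ι] [Fintype κ] (e : κ → ι)
    (he : Function.Injective e) (ν : Measure ℝ) [IsProbabilityMeasure ν] :
    MeasurePreserving (fun p : (ι → ℝ) × (κ → ℝ) => auxOver e p.1 p.2)
      ((Measure.pi fun _ : ι => ν).prod (Measure.pi fun _ : κ => ν))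
      (Measure.pi fun _ : ι => ν) := by
  classical
  have hm : Measurable (fun p : (ι → ℝ) × (κ → ℝ) => auxOver e p.1 p.2) := by
    refine measurable_pi_lambda _ fun i => ?_
    by_cases h : ∃ k, e k = i
    · obtain ⟨k, rfl⟩ := h
      simp only [auxOver, he.extend_apply]
      fun_prop
    · simp only [auxOver, Function.extend_apply' _ _ _ h]
      fun_prop
  refine ⟨hm, ?_⟩
  symm
  refine Measure.pi_eq fun s hs => ?_
  rw [Measure.map_apply hm (MeasurableSet.univ_pi hs)]
  have : (fun p : (ι → ℝ) × (κ → ℝ) => auxOver e p.1 p.2) ⁻¹' (Set.univ.pi s)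
      = (Set.univ.pi fun i => if ∃ k, e k = i then Set.univ else s i) ×ˢ
        (Set.univ.pi fun k => s (e k)) := by
    ext ⟨θ, ξ⟩
    simp only [Set.mem_preimage, Set.mem_pi, Set.mem_univ, true_implies, Set.mem_prod]
    constructor
    · intro h
      refine ⟨fun i => ?_, fun k => ?_⟩
      · split_ifs with hi
        · trivial
        · have := h i
          rwa [auxOver, Function.extend_apply' _ _ _ hi] at this
      · have := h (e k)
        rwa [auxOver, he.extend_apply] at this
    · rintro ⟨h1, h2⟩ i
      by_cases hi : ∃ k, e k = i
      · obtain ⟨k, rfl⟩ := hi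
        rw [auxOver, he.extend_apply]; exact h2 k
      · have := h1 i
        rw [if_neg hi] at this
        rwa [auxOver, Function.extend_apply' _ _ _ hi]
  rw [this, Measure.prod_prod, Measure.pi_pi, Measure.pi_pi]
  have h3 : ∏ k, ν (s (e k)) = ∏ i, if ∃ k, e k = i then ν (s i) else 1 := by
    rw [Finset.prod_ite, Finset.prod_const_one, mul_one]
    rw [← Finset.prod_image (s := Finset.univ) (g := e) (f := fun i => ν (s i))
      (fun x _ y _ h => he h)]
    refine Finset.prod_congr ?_ fun _ _ => rfl
    ext i; simp
  rw [h3, ← Finset.prod_mul_distrib]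
  refine Finset.prod_congr rfl fun i _ => ?_
  split_ifs <;> simp

lemma aux_resample {ι κ : Type*} [Fintype ι] [Fintype κ] (e : κ → ι)
    (he : Function.Injective e) (ν : Measure ℝ) [IsProbabilityMeasure ν]
    (B : Set (ι → ℝ)) (hB : MeasurableSet B) (q : ENNReal)
    (h : ∀ θ : ι → ℝ, (Measure.pi fun _ : κ => ν) {ξ | auxOver e θ ξ ∈ B} ≤ q) :
    (Measure.pi fun _ : ι => ν) B ≤ q := by
  have hp := aux_resample_map e he ν
  rw [← hp.measure_preimage hB.nullMeasurableSet, Measure.prod_apply (hp.measurable hB)]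
  calc _ ≤ ∫⁻ _ : ι → ℝ, q ∂(Measure.pi fun _ : ι => ν) := lintegral_mono fun θ => h θ
    _ = q := by simp

lemma aux_small_ball_int (v : NNReal) (hv : v ≠ 0) :
    ∫ x, Real.exp (-(3 / (2 * v) * x ^ 2)) ∂(gaussianReal 0 v) = 1 / 2 := by
  have hv' : (0 : ℝ) < v := by positivity
  rw [integral_gaussianReal_eq_integral_smul hv]
  have : ∀ x : ℝ, gaussianPDFReal 0 v x • Real.exp (-(3 / (2 * v) * x ^ 2))
      = (Real.sqrt (2 * Real.pi * v))⁻¹ * Real.exp (-(2 / v) * x ^ 2) := by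
    intro x
    rw [gaussianPDFReal, smul_eq_mul, mul_assoc, ← Real.exp_add]
    congr 2
    field_simp
    ring
  simp_rw [this]
  rw [integral_const_mul, integral_gaussian]
  rw [← Real.sqrt_inv, ← Real.sqrt_mul (by positivity)]
  rw [show (2 * Real.pi * (v : ℝ))⁻¹ * (Real.pi / (2 / v)) = (1 / 2) ^ 2 by
    field_simp]
  exact Real.sqrt_sq (by norm_num)

lemma aux_small_ball (w : ℕ) (v : NNReal) (hv : v ≠ 0) :
    (Measure.pi fun _ : Fin w => gaussianReal 0 v) {z | ∑ i, z i ^ 2 < w * v / 4}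
      ≤ ENNReal.ofReal ((3 / 4) ^ w) := by
  have hv' : (0 : ℝ) < v := by positivity
  set μ := Measure.pi fun _ : Fin w => gaussianReal 0 v
  set f : (Fin w → ℝ) → ℝ := fun z => ∏ i, Real.exp (-(3 / (2 * v) * z i ^ 2)) with hf
  have hIntEq : ∫ z, f z ∂μ = (1 / 2) ^ w := by
    rw [hf, integral_fintype_prod_eq_prod (𝕜 := ℝ)
      (f := fun _ (x : ℝ) => Real.exp (-(3 / (2 * v) * x ^ 2)))]
    simp [aux_small_ball_int v hv]
  have hfm : Measurable f := by rw [hf]; fun_prop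
  have hfi : Integrable f μ := by
    refine Integrable.of_bound hfm.aestronglyMeasurable 1 (ae_of_all _ fun z => ?_)
    rw [Real.norm_of_nonneg (Finset.prod_nonneg fun i _ => (Real.exp_pos _).le)]
    refine Finset.prod_le_one (fun i _ => (Real.exp_pos _).le) fun i _ => ?_
    rw [Real.exp_le_one_iff]
    have : 0 ≤ 3 / (2 * (v : ℝ)) * z i ^ 2 := by positivity
    linarith
  have hmk := mul_meas_ge_le_integral_of_nonneg (μ := μ) (f := f)
    (ae_of_all _ fun z => Finset.prod_nonneg fun i _ => (Real.exp_pos _).le) hfi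
    (Real.exp (-(3 / 8 * w)))
  rw [hIntEq] at hmk
  have hsub : {z : Fin w → ℝ | ∑ i, z i ^ 2 < w * v / 4} ⊆
      {z | Real.exp (-(3 / 8 * w)) ≤ f z} := by
    intro z hz
    simp only [Set.mem_ofPred_eq] at hz ⊢
    rw [hf]
    simp only
    rw [← Real.exp_sum, Real.exp_le_exp, Finset.sum_neg_distrib, ← Finset.mul_sum, neg_le_neg_iff]
    calc 3 / (2 * (v : ℝ)) * ∑ i, z i ^ 2 ≤ 3 / (2 * (v : ℝ)) * (w * v / 4) := by gcongr
      _ = 3 / 8 * w := by field_simp; ring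
  refine (measure_mono hsub).trans ?_
  rw [← ENNReal.ofReal_toReal (measure_ne_top μ _)]
  apply ENNReal.ofReal_le_ofReal
  have hexp : Real.exp (3 / 8) ≤ 3 / 2 := by
    have h1 : Real.exp (3 / 8) ^ 8 ≤ (3 / 2) ^ 8 := by
      rw [← Real.exp_nat_mul]
      have := Real.exp_one_lt_d9
      calc Real.exp (((8 : ℕ) : ℝ) * (3 / 8)) = Real.exp 1 ^ 3 := by
            rw [← Real.exp_nat_mul]; norm_num
        _ ≤ (2.7182818286) ^ 3 := by gcongr
        _ ≤ _ := by norm_num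
    exact (pow_le_pow_iff_left₀ (Real.exp_pos _).le (by norm_num) (by norm_num)).1 h1
  have h2 : Real.exp (-(3 / 8 * w)) * Real.exp (3 / 8) ^ w = 1 := by
    rw [← Real.exp_nat_mul, ← Real.exp_add]; simp; ring
  have h3 : Real.exp (3 / 8) ^ w ≤ (3 / 2) ^ w := by gcongr
  set m := (μ {z | Real.exp (-(3 / 8 * w)) ≤ f z}).toReal with hmdef
  have hmk' : Real.exp (-(3 / 8 * w)) * m ≤ (1 / 2) ^ w := hmk
  have hm0 : 0 ≤ m := ENNReal.toReal_nonneg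
  calc m = (Real.exp (-(3 / 8 * w)) * Real.exp (3 / 8) ^ w) * m := by rw [h2, one_mul]
    _ = Real.exp (3 / 8) ^ w * (Real.exp (-(3 / 8 * w)) * m) := by ring
    _ ≤ (3 / 2) ^ w * (1 / 2) ^ w := by gcongr
    _ = (3 / 4) ^ w := by rw [← mul_pow]; norm_num

lemma aux_uncurry {ι κ : Type*} [Fintype ι] [Fintype κ] (ν : Measure ℝ) [IsProbabilityMeasure ν] :
    MeasurePreserving (fun (z : ι → κ → ℝ) (p : ι × κ) => z p.1 p.2)
      (Measure.pi fun _ : ι => Measure.pi fun _ : κ => ν)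
      (Measure.pi fun _ : ι × κ => ν) := by
  have hm : Measurable (fun (z : ι → κ → ℝ) (p : ι × κ) => z p.1 p.2) := by fun_prop
  refine ⟨hm, ?_⟩
  symm
  refine Measure.pi_eq fun s hs => ?_
  rw [Measure.map_apply hm (MeasurableSet.univ_pi hs)]
  have : (fun (z : ι → κ → ℝ) (p : ι × κ) => z p.1 p.2) ⁻¹' (Set.univ.pi s)
      = Set.univ.pi fun i => Set.univ.pi fun k => s (i, k) := by
    ext z; simp [Set.mem_pi]
  rw [this, Measure.pi_pi, Fintype.prod_prod_type]
  simp_rw [Measure.pi_pi]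

lemma aux_matvec_small_ball (w : ℕ) {κ : Type*} [Fintype κ] (v : NNReal) (hv : v ≠ 0)
    (x : κ → ℝ) :
    (Measure.pi fun _ : Fin w × κ => gaussianReal 0 v)
      {ξ | ∑ i, (∑ j, ξ (i, j) * x j) ^ 2 < w * v / 4 * ∑ j, x j ^ 2}
      ≤ ENNReal.ofReal ((3 / 4) ^ w) := by
  by_cases hx : ∑ j, x j ^ 2 = 0
  · have : {ξ : Fin w × κ → ℝ | ∑ i, (∑ j, ξ (i, j) * x j) ^ 2 < w * v / 4 * ∑ j, x j ^ 2} = ∅ := by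
      ext ξ
      simp only [Set.mem_ofPred_eq, Set.mem_empty_iff_false, iff_false, not_lt, hx, mul_zero]
      positivity
    rw [this]; simp
  have hx0 : 0 < ∑ j, x j ^ 2 :=
    lt_of_le_of_ne (Finset.sum_nonneg fun i _ => sq_nonneg _) (Ne.symm hx)
  set u : NNReal := Real.toNNReal (∑ i, x i ^ 2) * v with hu
  have hu' : (u : ℝ) = (∑ i, x i ^ 2) * v := by
    rw [hu, NNReal.coe_mul, Real.coe_toNNReal _ hx0.le]
  have hu0 : u ≠ 0 := by
    have : (0 : ℝ) < v := by positivity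
    intro h
    have h2 : (u : ℝ) = 0 := by simp [h]
    rw [hu'] at h2
    exact absurd h2 (by positivity)
  rw [← (aux_uncurry (ι := Fin w) (κ := κ) (gaussianReal 0 v)).measure_preimage]
  swap
  · apply MeasurableSet.nullMeasurableSet
    apply measurableSet_lt <;> fun_prop
  have hmp : (Measure.pi fun _ : Fin w => Measure.pi fun _ : κ => gaussianReal 0 v).map
      (fun z i => ∑ j, x j * z i j) = Measure.pi fun _ : Fin w => gaussianReal 0 u := by
    rw [Measure.pi_map_pi (f := fun _ (y : κ → ℝ) => ∑ j, x j * y j)]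
    · simp_rw [aux_gauss_lin]; rfl
    · intro i; exact Measurable.aemeasurable (by fun_prop)
  have hsb := aux_small_ball w u hu0
  rw [← hmp, Measure.map_apply (by fun_prop)] at hsb
  swap
  · apply measurableSet_lt <;> fun_prop
  refine le_trans (measure_mono ?_) hsb
  intro z hz
  simp only [Set.mem_preimage, Set.mem_ofPred_eq] at hz ⊢
  rw [hu']
  calc _ = ∑ i, (∑ j, z i j * x j) ^ 2 := by simp_rw [mul_comm]
    _ < _ := hz
    _ = _ := by ring

lemma aux_second_moment (v : NNReal) : ∫ x, x ^ 2 ∂(gaussianReal 0 v) = v := by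
  have := variance_fun_id_gaussianReal (μ := 0) (v := v)
  rw [variance_of_integral_eq_zero (by fun_prop) (by simp)] at this
  exact this

lemma aux_sq_integrable (v : NNReal) : Integrable (fun x : ℝ => x ^ 2) (gaussianReal 0 v) :=
  (memLp_id_gaussianReal (μ := 0) (v := v) 2).integrable_sq

lemma aux_frob {κ : Type*} [Fintype κ] (v : NNReal) (T : ℝ) (hT : 0 < T) :
    (Measure.pi fun _ : κ => gaussianReal 0 v) {ξ | T < ∑ i, ξ i ^ 2}
      ≤ ENNReal.ofReal (Fintype.card κ * v / T) := by
  set μ := Measure.pi fun _ : κ => gaussianReal 0 v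
  have hi : ∀ i ∈ (Finset.univ : Finset κ), Integrable (fun ξ : κ → ℝ => ξ i ^ 2) μ := by
    intro i _
    exact (measurePreserving_eval (fun _ : κ => gaussianReal 0 v) i).integrable_comp_of_integrable
      (g := fun x : ℝ => x ^ 2) (aux_sq_integrable v)
  have hIntEq : ∫ ξ, ∑ i, ξ i ^ 2 ∂μ = Fintype.card κ * v := by
    rw [integral_finsetSum _ hi]
    have : ∀ i, ∫ ξ : κ → ℝ, ξ i ^ 2 ∂μ = v := by
      intro i
      rw [← aux_second_moment v, ← (measurePreserving_eval (fun _ : κ => gaussianReal 0 v) i).map_eq,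
        integral_map (measurable_pi_apply i).aemeasurable (by fun_prop)]
    simp [this]
  have hmk := mul_meas_ge_le_integral_of_nonneg (μ := μ) (f := fun ξ => ∑ i, ξ i ^ 2)
    (ae_of_all _ fun z => Finset.sum_nonneg fun i _ => sq_nonneg _) (integrable_finsetSum _ hi) T
  rw [hIntEq] at hmk
  refine (measure_mono (t := {ξ : κ → ℝ | T ≤ ∑ i, ξ i ^ 2}) fun z hz => (show T < _ from hz).le).trans ?_
  rw [← ENNReal.ofReal_toReal (measure_ne_top μ _)]
  apply ENNReal.ofReal_le_ofReal
  rw [le_div_iff₀ hT, mul_comm]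
  exact hmk

lemma aux_lin_upper {κ : Type*} [Fintype κ] (v : NNReal) (a : κ → ℝ) (T : ℝ) (hT : 0 < T) :
    (Measure.pi fun _ : κ => gaussianReal 0 v) {ξ | T < (∑ i, a i * ξ i) ^ 2}
      ≤ ENNReal.ofReal ((∑ i, a i ^ 2) * v / T) := by
  have h := aux_frob (κ := Unit) (Real.toNNReal (∑ i, a i ^ 2) * v) T hT
  have h0 : 0 ≤ ∑ i, a i ^ 2 := Finset.sum_nonneg fun i _ => sq_nonneg _
  have hmp : (Measure.pi fun _ : κ => gaussianReal 0 v).map (fun ξ => ∑ i, a i * ξ i)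
    = _ := aux_gauss_lin v a
  have hs : MeasurableSet {z : ℝ | T < z ^ 2} := by apply measurableSet_lt <;> fun_prop
  have h2 : gaussianReal 0 (Real.toNNReal (∑ i, a i ^ 2) * v) {z : ℝ | T < z ^ 2}
      ≤ ENNReal.ofReal ((∑ i, a i ^ 2) * v / T) := by
    rw [← (measurePreserving_eval (fun _ : Unit =>
      gaussianReal 0 (Real.toNNReal (∑ i, a i ^ 2) * v)) ()).measure_preimage hs.nullMeasurableSet]
    simpa [Real.coe_toNNReal _ h0] using h
  rw [← hmp, Measure.map_apply (by fun_prop) hs] at h2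
  exact h2

lemma aux_lin_lower {κ : Type*} [Fintype κ] (v : NNReal) (a : κ → ℝ) (b δ c : ℝ)
    (hc : 0 < c) (hca : c ^ 2 ≤ (∑ i, a i ^ 2) * v) :
    (Measure.pi fun _ : κ => gaussianReal 0 v) {ξ | |(∑ i, a i * ξ i) - b| ≤ δ}
      ≤ ENNReal.ofReal (2 * δ / c) := by
  have h0 : 0 ≤ ∑ i, a i ^ 2 := Finset.sum_nonneg fun i _ => sq_nonneg _
  have hs : MeasurableSet {z : ℝ | |z - b| ≤ δ} := by apply measurableSet_le <;> fun_prop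
  have hmp : (Measure.pi fun _ : κ => gaussianReal 0 v).map (fun ξ => ∑ i, a i * ξ i)
    = _ := aux_gauss_lin v a
  set u := Real.toNNReal (∑ i, a i ^ 2) * v with hu
  have hu' : (u : ℝ) = (∑ i, a i ^ 2) * v := by
    rw [hu, NNReal.coe_mul, Real.coe_toNNReal _ h0]
  have hu0 : (0 : ℝ) < u := lt_of_lt_of_le (by positivity) (hu' ▸ hca)
  have hune : u ≠ 0 := by intro h; simp [h] at hu0
  have h2 : gaussianReal 0 u {z : ℝ | |z - b| ≤ δ} ≤ ENNReal.ofReal (2 * δ / c) := by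
    rw [gaussianReal_apply 0 hune]
    calc _ ≤ ∫⁻ x in {z : ℝ | |z - b| ≤ δ}, ENNReal.ofReal (1 / c) := by
          refine lintegral_mono fun x => ?_
          rw [gaussianPDF]
          apply ENNReal.ofReal_le_ofReal
          rw [gaussianPDFReal]
          have h1 : Real.exp (-(x - 0) ^ 2 / (2 * u)) ≤ 1 := by
            rw [Real.exp_le_one_iff]
            apply div_nonpos_of_nonpos_of_nonneg
            · nlinarith [sq_nonneg (x - 0)]
            · positivity
          have h3 : c ≤ Real.sqrt (2 * Real.pi * u) := by
            apply Real.le_sqrt_of_sq_le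
            rw [← hu'] at hca
            nlinarith [Real.pi_gt_three]
          calc _ ≤ (Real.sqrt (2 * Real.pi * u))⁻¹ * 1 := by gcongr
            _ ≤ 1 / c := by
              rw [mul_one, ← one_div]; gcongr
      _ = ENNReal.ofReal (2 * δ / c) := by
          rw [setLIntegral_const]
          have : {z : ℝ | |z - b| ≤ δ} = Metric.closedBall b δ := by
            ext z; simp [Real.dist_eq]
          rw [this, Real.volume_closedBall, ← ENNReal.ofReal_mul (by positivity)]
          congr 1; ring
  rw [← hmp, Measure.map_apply (by fun_prop) hs] at h2
  exact h2

lemma aux_mgf_lin {κ : Type*} [Fintype κ] (v : NNReal) (a : κ → ℝ) (t : ℝ) :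
    ∫⁻ ξ, ENNReal.ofReal (Real.exp (t * ∑ i, a i * ξ i)) ∂(Measure.pi fun _ : κ => gaussianReal 0 v)
      = ENNReal.ofReal (Real.exp ((∑ i, a i ^ 2) * v * t ^ 2 / 2)) := by
  have h0 : 0 ≤ ∑ i, a i ^ 2 := Finset.sum_nonneg fun i _ => sq_nonneg _
  have hmp := aux_gauss_lin v a
  have h1 : ∫⁻ z, ENNReal.ofReal (Real.exp (t * z))
      ∂(gaussianReal 0 (Real.toNNReal (∑ i, a i ^ 2) * v))
      = ENNReal.ofReal (Real.exp ((∑ i, a i ^ 2) * v * t ^ 2 / 2)) := by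
    rw [← ofReal_integral_eq_lintegral_ofReal (integrable_exp_mul_gaussianReal t)
      (ae_of_all _ fun z => (Real.exp_pos _).le)]
    have := mgf_gaussianReal (p := gaussianReal 0 (Real.toNNReal (∑ i, a i ^ 2) * v)) (X := id)
      (by rw [Measure.map_id]) t
    simp only [mgf, id] at this
    rw [this, NNReal.coe_mul, Real.coe_toNNReal _ h0]
    simp
  rw [← hmp, lintegral_map (by fun_prop) (by fun_prop)] at h1
  exact h1

section
open scoped Matrix.Norms.L2Operator

lemma aux_mulVec_norm {m n : Type*} [Fintype m] [Fintype n] [DecidableEq n] (A : Matrix m n ℝ)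
    (x : n → ℝ) : ‖WithLp.toLp 2 (A.mulVec x)‖ ≤ ‖A‖ * ‖WithLp.toLp 2 x‖ :=
  A.l2_opNorm_mulVec (WithLp.toLp 2 x)

lemma aux_opnorm_le {m n : Type*} [Fintype m] [Fintype n] [DecidableEq n] (A : Matrix m n ℝ)
    (T : ℝ) (hT : 0 ≤ T) (h : ∀ x : n → ℝ, ‖WithLp.toLp 2 (A.mulVec x)‖ ≤ T * ‖WithLp.toLp 2 x‖) :
    ‖A‖ ≤ T := by
  rw [Matrix.l2_opNorm_def]
  refine ContinuousLinearMap.opNorm_le_bound _ hT fun x => ?_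
  exact h x.ofLp

lemma aux_opnorm_witness {w : ℕ} (A : Matrix (Fin w) (Fin w) ℝ) (hA : 0 < ‖A‖) :
    ∃ x0 y0 : EuclideanSpace ℝ (Fin w), ‖x0‖ = 1 ∧ ‖y0‖ = 1 ∧
      ∀ x ∈ Metric.ball x0 (1 / 4), ∀ y ∈ Metric.ball y0 (1 / 4),
        ‖A‖ / 4 ≤ ∑ p : Fin w × Fin w, (x p.1 * y p.2) * A p.1 p.2 := by
  obtain ⟨y, hy⟩ : ∃ y : Fin w → ℝ,
      9 / 10 * ‖A‖ * ‖WithLp.toLp 2 y‖ < ‖WithLp.toLp 2 (A.mulVec y)‖ := by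
    by_contra! h
    have := aux_opnorm_le A (9 / 10 * ‖A‖) (by positivity) h
    linarith
  have hbil : ∀ x y : EuclideanSpace ℝ (Fin w),
      ∑ p : Fin w × Fin w, (x p.1 * y p.2) * A p.1 p.2
        = inner ℝ x (WithLp.toLp 2 (A.mulVec y.ofLp)) := by
    intro x y
    rw [PiLp.inner_apply, Fintype.sum_prod_type]
    refine Finset.sum_congr rfl fun i _ => ?_
    simp only [Matrix.mulVec, dotProduct, RCLike.inner_apply, conj_trivial]
    rw [Finset.sum_mul]
    refine Finset.sum_congr rfl fun j _ => by ring
  set f : EuclideanSpace ℝ (Fin w) → EuclideanSpace ℝ (Fin w) :=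
    fun y => WithLp.toLp 2 (A.mulVec y.ofLp) with hf
  have hfa : ∀ y z, f (y + z) = f y + f z := by
    intro y z; simp [hf, Matrix.mulVec_add]
  have hfs : ∀ (c : ℝ) y, f (c • y) = c • f y := by
    intro c y; simp [hf, Matrix.mulVec_smul]
  have hfn : ∀ y, ‖f y‖ ≤ ‖A‖ * ‖y‖ := fun y => aux_mulVec_norm A y.ofLp
  set Y := (WithLp.toLp 2 y : EuclideanSpace ℝ (Fin w)) with hY
  have hy' : 9 / 10 * ‖A‖ * ‖Y‖ < ‖f Y‖ := hy
  have hfY : 0 < ‖f Y‖ := lt_of_le_of_lt (by positivity) hy'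
  have hY0 : 0 < ‖Y‖ := by
    by_contra h
    have h1 : ‖Y‖ = 0 := le_antisymm (not_lt.1 h) (norm_nonneg _)
    have := hfn Y
    rw [h1] at this; linarith
  set y0 := ‖Y‖⁻¹ • Y with hy0
  have hy01 : ‖y0‖ = 1 := by
    rw [hy0, norm_smul, norm_inv, norm_norm, inv_mul_cancel₀ hY0.ne']
  have hfy0 : 9 / 10 * ‖A‖ < ‖f y0‖ := by
    rw [hy0, hfs, norm_smul, norm_inv, norm_norm, inv_mul_eq_div, lt_div_iff₀ hY0]
    exact hy'
  have hfy00 : 0 < ‖f y0‖ := lt_of_le_of_lt (by positivity) hfy0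
  refine ⟨‖f y0‖⁻¹ • f y0, y0, ?_, hy01, ?_⟩
  · rw [norm_smul, norm_inv, norm_norm, inv_mul_cancel₀ hfy00.ne']
  set x0 := ‖f y0‖⁻¹ • f y0 with hx0
  have hx01 : ‖x0‖ = 1 := by
    rw [hx0, norm_smul, norm_inv, norm_norm, inv_mul_cancel₀ hfy00.ne']
  have hin : inner ℝ x0 (f y0) = ‖f y0‖ := by
    rw [hx0, real_inner_smul_left, real_inner_self_eq_norm_sq]
    field_simp
  intro x hx y hy
  rw [hbil]
  change _ ≤ inner ℝ x (f y)
  obtain ⟨u, rfl⟩ : ∃ u, x = x0 + u := ⟨x - x0, by abel⟩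
  obtain ⟨z, rfl⟩ : ∃ z, y = y0 + z := ⟨y - y0, by abel⟩
  have hu : ‖u‖ ≤ 1 / 4 := by
    have := Metric.mem_ball.1 hx
    rw [dist_eq_norm, add_sub_cancel_left] at this; exact this.le
  have hz : ‖z‖ ≤ 1 / 4 := by
    have := Metric.mem_ball.1 hy
    rw [dist_eq_norm, add_sub_cancel_left] at this; exact this.le
  rw [hfa, inner_add_left, inner_add_right, inner_add_right, hin]
  have e1 : |inner ℝ x0 (f z)| ≤ 1 * (‖A‖ * (1 / 4)) := by
    refine (abs_real_inner_le_norm _ _).trans ?_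
    rw [hx01]
    gcongr
    exact (hfn z).trans (by gcongr)
  have e2 : |inner ℝ u (f y0)| ≤ 1 / 4 * (‖A‖ * 1) := by
    refine (abs_real_inner_le_norm _ _).trans ?_
    gcongr
    exact (hfn y0).trans (by rw [hy01])
  have e3 : |inner ℝ u (f z)| ≤ 1 / 4 * (‖A‖ * (1 / 4)) := by
    refine (abs_real_inner_le_norm _ _).trans ?_
    gcongr
    exact (hfn z).trans (by gcongr)
  have := neg_abs_le (inner ℝ x0 (f z))
  have := neg_abs_le (inner ℝ u (f y0))
  have := neg_abs_le (inner ℝ u (f z))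
  linarith

lemma aux_opnorm_prob (w : ℕ) (hw : 0 < w) (v : NNReal) (s : ℝ) (hs : 0 < s)
    (hsv : s ^ 2 = w * v) :
    (Measure.pi fun _ : Fin w × Fin w => gaussianReal 0 v)
      {ξ | 56 * s < ‖(Matrix.of fun i j => ξ (i, j) : Matrix (Fin w) (Fin w) ℝ)‖}
      ≤ ENNReal.ofReal ((3 / 4) ^ w) := by
  have hw' : (0 : ℝ) < w := by exact_mod_cast hw
  have hv : (0 : ℝ) < v := by
    by_contra h
    have h1 : (v : ℝ) = 0 := le_antisymm (not_lt.1 h) v.2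
    rw [h1, mul_zero] at hsv
    exact absurd hsv (by positivity)
  set t : ℝ := s / v with ht
  have hts : t * s = w := by rw [ht]; field_simp; linarith
  have htv : v * t ^ 2 = w := by rw [ht]; field_simp; linarith
  set μ := Measure.pi fun _ : Fin w × Fin w => gaussianReal 0 v
  set β : Measure (EuclideanSpace ℝ (Fin w)) := volume.restrict (Metric.ball 0 2) with hβ
  have : IsFiniteMeasure β := ⟨by rw [hβ]; simp [Metric.isBounded_ball.measure_lt_top]⟩
  set g : (Fin w × Fin w → ℝ) → EuclideanSpace ℝ (Fin w) × EuclideanSpace ℝ (Fin w) → ENNReal := fun ξ p =>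
    ENNReal.ofReal (Real.exp (t * ∑ q : Fin w × Fin w, (p.1 q.1 * p.2 q.2) * ξ q)) with hg
  have hgm : Measurable (Function.uncurry g) := by
    rw [hg]; unfold Function.uncurry; fun_prop
  set F : (Fin w × Fin w → ℝ) → ENNReal := fun ξ => ∫⁻ p, g ξ p ∂(β.prod β) with hF
  have hFm : Measurable F := hgm.lintegral_prod_right'
  set V : ENNReal := volume (Metric.ball (0 : EuclideanSpace ℝ (Fin w)) 1) with hV
  have hV0 : V ≠ 0 := (Metric.measure_ball_pos _ _ one_pos).ne'
  have hVt : V ≠ ⊤ := Metric.isBounded_ball.measure_lt_top.ne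
  have hfr : Module.finrank ℝ (EuclideanSpace ℝ (Fin w)) = w := by simp
  have hb2 : volume (Metric.ball (0 : EuclideanSpace ℝ (Fin w)) 2) = ENNReal.ofReal (2 ^ w) * V := by
    rw [Measure.addHaar_ball_of_pos volume _ (by norm_num : (0 : ℝ) < 2), hfr]
  have hb4 : ∀ x : EuclideanSpace ℝ (Fin w), volume (Metric.ball x (1 / 4)) = ENNReal.ofReal ((1 / 4) ^ w) * V := by
    intro x
    rw [Measure.addHaar_ball_of_pos volume _ (by norm_num : (0 : ℝ) < 1 / 4), hfr]
  have hup : ∫⁻ ξ, F ξ ∂μ ≤ ENNReal.ofReal (Real.exp (8 * w)) * (ENNReal.ofReal (2 ^ w) * V) ^ 2 := by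
    rw [hF, lintegral_lintegral_swap hgm.aemeasurable]
    have h1 : ∀ᵐ p ∂(β.prod β), ∫⁻ ξ, g ξ p ∂μ ≤ ENNReal.ofReal (Real.exp (8 * w)) := by
      rw [hβ, Measure.prod_restrict]
      refine (ae_restrict_mem (Metric.isOpen_ball.measurableSet.prod
        Metric.isOpen_ball.measurableSet)).mono fun p hp => ?_
      simp only [hg]
      rw [aux_mgf_lin]
      apply ENNReal.ofReal_le_ofReal
      rw [Real.exp_le_exp]
      have h2 : ∑ q : Fin w × Fin w, (p.1 q.1 * p.2 q.2) ^ 2 = ‖p.1‖ ^ 2 * ‖p.2‖ ^ 2 := by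
        rw [EuclideanSpace.real_norm_sq_eq, EuclideanSpace.real_norm_sq_eq, Fintype.sum_prod_type,
          Finset.sum_mul_sum]
        simp_rw [mul_pow]
      rw [h2, mul_assoc, htv]
      have hp1 : ‖p.1‖ ≤ 2 := (mem_ball_zero_iff.1 hp.1).le
      have hp2 : ‖p.2‖ ≤ 2 := (mem_ball_zero_iff.1 hp.2).le
      calc ‖p.1‖ ^ 2 * ‖p.2‖ ^ 2 * (w : ℝ) / 2 ≤ 2 ^ 2 * 2 ^ 2 * (w : ℝ) / 2 := by gcongr
        _ = 8 * (w : ℝ) := by ring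
    refine (lintegral_mono_ae h1).trans ?_
    rw [lintegral_const, ← Set.univ_prod_univ, Measure.prod_prod, hβ, Measure.restrict_apply_univ,
      hb2, sq]
  have hlow : ∀ ξ : Fin w × Fin w → ℝ,
      56 * s < ‖(Matrix.of fun i j => ξ (i, j) : Matrix (Fin w) (Fin w) ℝ)‖ →
      ENNReal.ofReal (Real.exp (14 * w)) * (ENNReal.ofReal ((1 / 4) ^ w) * V) ^ 2 ≤ F ξ := by
    intro ξ hξ
    obtain ⟨x0, y0, hx0, hy0, h⟩ := aux_opnorm_witness
      (Matrix.of fun i j => ξ (i, j) : Matrix (Fin w) (Fin w) ℝ) (lt_trans (by positivity) hξ)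
    have hsub : ∀ x : EuclideanSpace ℝ (Fin w), ‖x‖ = 1 → Metric.ball x (1 / 4) ⊆ Metric.ball 0 2 := by
      intro x hx
      apply Metric.ball_subset_ball'
      rw [dist_zero_right, hx]; norm_num
    have hbm : ∀ x : EuclideanSpace ℝ (Fin w), ‖x‖ = 1 → β (Metric.ball x (1 / 4)) = ENNReal.ofReal ((1 / 4) ^ w) * V := by
      intro x hx
      rw [hβ, Measure.restrict_apply Metric.isOpen_ball.measurableSet,
        Set.inter_eq_left.2 (hsub x hx), hb4]
    calc _ = ∫⁻ p in Metric.ball x0 (1 / 4) ×ˢ Metric.ball y0 (1 / 4),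
            ENNReal.ofReal (Real.exp (14 * w)) ∂(β.prod β) := by
          rw [setLIntegral_const, Measure.prod_prod, hbm _ hx0, hbm _ hy0, sq]
      _ ≤ ∫⁻ p in Metric.ball x0 (1 / 4) ×ˢ Metric.ball y0 (1 / 4), g ξ p ∂(β.prod β) := by
          refine setLIntegral_mono' (Metric.isOpen_ball.measurableSet.prod
            Metric.isOpen_ball.measurableSet) fun p hp => ?_
          apply ENNReal.ofReal_le_ofReal
          rw [Real.exp_le_exp]
          have := h p.1 hp.1 p.2 hp.2
          simp only [Matrix.of_apply, Prod.mk.eta] at this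
          calc 14 * (w : ℝ) = t * (56 * s / 4) := by rw [← hts]; ring
            _ ≤ t * _ := by
              have : 0 < t := by positivity
              gcongr
              linarith
      _ ≤ _ := setLIntegral_le_lintegral _ _
  have hmk := mul_meas_ge_le_lintegral (μ := μ) hFm
    (ENNReal.ofReal (Real.exp (14 * w)) * (ENNReal.ofReal ((1 / 4) ^ w) * V) ^ 2)
  refine (measure_mono (t := {ξ | ENNReal.ofReal (Real.exp (14 * w)) *
    (ENNReal.ofReal ((1 / 4) ^ w) * V) ^ 2 ≤ F ξ}) fun ξ hξ => hlow ξ hξ).trans ?_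
  set m := μ {ξ | ENNReal.ofReal (Real.exp (14 * w)) *
    (ENNReal.ofReal ((1 / 4) ^ w) * V) ^ 2 ≤ F ξ} with hm
  have hmt : m ≠ ⊤ := measure_ne_top μ _
  have h3 := hmk.trans hup
  obtain ⟨r, hr, hr0⟩ : ∃ r : ℝ, m = ENNReal.ofReal r ∧ 0 ≤ r :=
    ⟨m.toReal, (ENNReal.ofReal_toReal hmt).symm, ENNReal.toReal_nonneg⟩
  rw [hr]
  rw [hr] at h3
  apply ENNReal.ofReal_le_ofReal
  have h4 : ENNReal.ofReal (Real.exp (14 * w) * ((1 / 4) ^ w) ^ 2 * r) * V ^ 2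
      ≤ ENNReal.ofReal (Real.exp (8 * w) * (2 ^ w) ^ 2) * V ^ 2 := by
    rw [ENNReal.ofReal_mul (by positivity), ENNReal.ofReal_mul (by positivity),
      ENNReal.ofReal_mul (by positivity), ENNReal.ofReal_pow (by positivity),
      ENNReal.ofReal_pow (p := (2 : ℝ) ^ w) (by positivity)]
    calc _ = _ := by ring
      _ ≤ _ := h3
      _ = _ := by ring
  rw [ENNReal.mul_le_mul_iff_left (by positivity) (by finiteness),
    ENNReal.ofReal_le_ofReal_iff (by positivity)] at h4
  have h5 : Real.exp (14 * w) = Real.exp (8 * w) * (Real.exp 1 ^ 6) ^ w := by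
    rw [← Real.exp_nat_mul, ← Real.exp_nat_mul, ← Real.exp_add]; congr 1; push_cast; ring
  have h6 : (256 / 3 : ℝ) ^ w ≤ (Real.exp 1 ^ 6) ^ w := by
    gcongr
    calc (256 / 3 : ℝ) ≤ 2.7182818283 ^ 6 := by norm_num
      _ ≤ _ := by gcongr; exact Real.exp_one_gt_d9.le
  rw [h5] at h4
  have h7 : (256 / 3 : ℝ) ^ w * ((1 / 4) ^ w) ^ 2 * r ≤ (2 ^ w) ^ 2 := by
    have h8 : (Real.exp 1 ^ 6) ^ w * ((1 / 4) ^ w) ^ 2 * r ≤ (2 ^ w) ^ 2 := by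
      refine le_of_mul_le_mul_left ?_ (Real.exp_pos (8 * w))
      linarith
    refine le_trans ?_ h8
    gcongr
  have h9 : (256 / 3 : ℝ) ^ w * ((1 / 4) ^ w) ^ 2 = (16 / 3) ^ w := by
    rw [← pow_mul, mul_comm w 2, pow_mul, ← mul_pow]; norm_num
  have h10 : ((2 : ℝ) ^ w) ^ 2 = (16 / 3) ^ w * (3 / 4) ^ w := by
    rw [← pow_mul, mul_comm w 2, pow_mul, ← mul_pow]; norm_num
  rw [h9, h10] at h7
  exact le_of_mul_le_mul_left h7 (by positivity)

end

/-- partial products of a finite family, latest factor on the left -/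
def auxPP {R : Type*} [Monoid R] {N : ℕ} (f : Fin N → R) : ℕ → R
  | 0 => 1
  | k + 1 => if h : k < N then f ⟨k, h⟩ * auxPP f k else auxPP f k

lemma auxPP_take {R : Type*} [Monoid R] {N : ℕ} (f : Fin N → R) (k : ℕ) (hk : k ≤ N) :
    auxPP f k = ((List.ofFn f).take k).reverse.prod := by
  induction k with
  | zero => simp [auxPP]
  | succ k ih =>
    have hk' : k < N := hk
    rw [auxPP, dif_pos hk', ih hk'.le, List.take_add_one]
    simp [hk']

lemma auxPP_eq {R : Type*} [Monoid R] {N : ℕ} (f : Fin N → R) :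
    auxPP f N = (List.ofFn f).reverse.prod := by
  rw [auxPP_take f N le_rfl, List.take_of_length_le (by simp)]

/-- product of the first layers -/
def auxH {n0 nL w L : ℕ} (θ : DLNParams n0 nL w L) (k : ℕ) : Matrix (Fin w) (Fin n0) ℝ :=
  auxPP (dlnWmid θ) k * dlnW1 θ

lemma aux_dlnMatrix {n0 nL w L : ℕ} (θ : DLNParams n0 nL w L) (i : Fin nL) (j : Fin n0) :
    dlnMatrix θ i j = (dlnWL θ * auxH θ (L - 2)) i j := by
  rw [dlnMatrix, auxH, auxPP_eq, Matrix.mul_assoc]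

lemma auxPP_diff {n0 nL w L : ℕ} (k : ℕ) (i j : Fin w) :
    Differentiable ℝ (fun θ : DLNParams n0 nL w L => auxPP (dlnWmid θ) k i j) := by
  induction k generalizing i j with
  | zero => simp only [auxPP]; fun_prop
  | succ k ih =>
    simp only [auxPP]
    split_ifs with h
    · simp only [Matrix.mul_apply, dlnWmid, Matrix.of_apply]
      have := fun l => ih l j
      fun_prop
    · exact ih i j

lemma auxH_diff {n0 nL w L : ℕ} (k : ℕ) (i : Fin w) (j : Fin n0) :
    Differentiable ℝ (fun θ : DLNParams n0 nL w L => auxH θ k i j) := by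
  simp only [auxH, Matrix.mul_apply, dlnW1, Matrix.of_apply]
  have := fun l => auxPP_diff (n0 := n0) (nL := nL) (w := w) (L := L) k i l
  fun_prop

lemma aux_dlnMatrix_diff {n0 nL w L : ℕ} :
    Differentiable ℝ (fun θ : DLNParams n0 nL w L => dlnMatrix θ) := by
  rw [differentiable_pi]; intro i
  rw [differentiable_pi]; intro j
  simp only [aux_dlnMatrix, Matrix.mul_apply, dlnWL, Matrix.of_apply]
  have := fun l => auxH_diff (n0 := n0) (nL := nL) (w := w) (L := L) (L - 2) l j
  fun_prop

section
open scoped Matrix.Norms.L2Operator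

lemma aux_norm_sq {ι : Type*} [Fintype ι] (x : ι → ℝ) :
    ‖(WithLp.toLp 2 x : EuclideanSpace ℝ ι)‖ ^ 2 = ∑ i, x i ^ 2 := by
  rw [EuclideanSpace.real_norm_sq_eq]

lemma aux_opnorm_frob {m n : Type*} [Fintype m] [Fintype n] [DecidableEq n] (A : Matrix m n ℝ)
    (T : ℝ) (hT : 0 ≤ T) (h : ∑ i, ∑ j, A i j ^ 2 ≤ T ^ 2) : ‖A‖ ≤ T := by
  refine aux_opnorm_le A T hT fun x => ?_
  refine (pow_le_pow_iff_left₀ (norm_nonneg _) (by positivity) two_ne_zero).1 ?_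
  rw [mul_pow, aux_norm_sq, aux_norm_sq]
  calc ∑ i, (A.mulVec x i) ^ 2 ≤ ∑ i, (∑ j, A i j ^ 2) * ∑ j, x j ^ 2 := by
        refine Finset.sum_le_sum fun i _ => ?_
        exact Finset.sum_mul_sq_le_sq_mul_sq _ _ _
    _ = (∑ i, ∑ j, A i j ^ 2) * ∑ j, x j ^ 2 := by rw [Finset.sum_mul]
    _ ≤ _ := by gcongr

lemma aux_entry_le {m n : Type*} [Fintype m] [Fintype n] [DecidableEq n] (A : Matrix m n ℝ)
    (i : m) (j : n) : |A i j| ≤ ‖A‖ := by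
  have h := aux_mulVec_norm A (Pi.single j 1)
  have h1 : ‖(WithLp.toLp 2 (Pi.single j 1) : EuclideanSpace ℝ n)‖ = 1 := by
    simp
  rw [h1, mul_one] at h
  refine le_trans ?_ h
  have h2 := PiLp.norm_apply_le (WithLp.toLp 2 (A.mulVec (Pi.single j 1)) : EuclideanSpace ℝ m) i
  simpa using h2

lemma aux_step_left {m n l : ℕ} (X X' : Matrix (Fin m) (Fin n) ℝ) (P P' : Matrix (Fin n) (Fin l) ℝ)
    (k : ℕ) (B ρ : ℝ) (hB : 0 ≤ B) (hρ : 0 ≤ ρ) (hρ1 : ρ ≤ 1) (hX : ‖X‖ ≤ B) (hP : ‖P‖ ≤ B ^ k)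
    (hX' : ‖X' - X‖ ≤ ρ * B) (hP' : ‖P' - P‖ ≤ k * ρ * (2 * B) ^ k) :
    ‖X * P‖ ≤ B ^ (k + 1) ∧ ‖X' * P' - X * P‖ ≤ ((k + 1 : ℕ) : ℝ) * ρ * (2 * B) ^ (k + 1) := by
  constructor
  · calc _ ≤ ‖X‖ * ‖P‖ := Matrix.l2_opNorm_mul _ _
      _ ≤ B * B ^ k := by gcongr
      _ = _ := by ring
  have h1 : ‖X'‖ ≤ 2 * B := by
    have : X' = X + (X' - X) := by abel
    rw [this]
    refine (norm_add_le _ _).trans ?_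
    nlinarith
  have h2 : B ^ k ≤ (2 * B) ^ k := by gcongr; linarith
  have : X' * P' - X * P = X' * (P' - P) + (X' - X) * P := by
    rw [Matrix.mul_sub, Matrix.sub_mul]; abel
  rw [this]
  calc _ ≤ ‖X'‖ * ‖P' - P‖ + ‖X' - X‖ * ‖P‖ :=
        (norm_add_le _ _).trans (add_le_add (Matrix.l2_opNorm_mul _ _) (Matrix.l2_opNorm_mul _ _))
    _ ≤ (2 * B) * (k * ρ * (2 * B) ^ k) + (ρ * (2 * B)) * (2 * B) ^ k := by
        gcongr
        · exact hX'.trans (by nlinarith)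
        · exact hP.trans h2
    _ = _ := by push_cast; ring

lemma aux_step_right {m n l : ℕ} (X X' : Matrix (Fin n) (Fin l) ℝ) (P P' : Matrix (Fin m) (Fin n) ℝ)
    (k : ℕ) (B ρ : ℝ) (hB : 0 ≤ B) (hρ : 0 ≤ ρ) (hρ1 : ρ ≤ 1) (hX : ‖X‖ ≤ B) (hP : ‖P‖ ≤ B ^ k)
    (hX' : ‖X' - X‖ ≤ ρ * B) (hP' : ‖P' - P‖ ≤ k * ρ * (2 * B) ^ k) :
    ‖P * X‖ ≤ B ^ (k + 1) ∧ ‖P' * X' - P * X‖ ≤ ((k + 1 : ℕ) : ℝ) * ρ * (2 * B) ^ (k + 1) := by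
  constructor
  · calc _ ≤ ‖P‖ * ‖X‖ := Matrix.l2_opNorm_mul _ _
      _ ≤ B ^ k * B := by gcongr
      _ = _ := by ring
  have h1 : ‖X'‖ ≤ 2 * B := by
    have : X' = X + (X' - X) := by abel
    rw [this]
    refine (norm_add_le _ _).trans ?_
    nlinarith
  have h2 : B ^ k ≤ (2 * B) ^ k := by gcongr; linarith
  have : P' * X' - P * X = (P' - P) * X' + P * (X' - X) := by
    rw [Matrix.mul_sub, Matrix.sub_mul]; abel
  rw [this]
  calc _ ≤ ‖P' - P‖ * ‖X'‖ + ‖P‖ * ‖X' - X‖ :=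
        (norm_add_le _ _).trans (add_le_add (Matrix.l2_opNorm_mul _ _) (Matrix.l2_opNorm_mul _ _))
    _ ≤ (k * ρ * (2 * B) ^ k) * (2 * B) + (2 * B) ^ k * (ρ * (2 * B)) := by
        gcongr
        · exact hP.trans h2
        · exact hX'.trans (by nlinarith)
    _ = _ := by push_cast; ring

lemma aux_one_norm {w : ℕ} : ‖(1 : Matrix (Fin w) (Fin w) ℝ)‖ ≤ 1 :=
  aux_opnorm_le _ 1 zero_le_one fun x => by simp

lemma auxPP_pert {N w : ℕ} (f f' : Fin N → Matrix (Fin w) (Fin w) ℝ) (B ρ : ℝ) (hB : 0 ≤ B)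
    (hρ : 0 ≤ ρ) (hρ1 : ρ ≤ 1) (hf : ∀ i, ‖f i‖ ≤ B) (hf' : ∀ i, ‖f' i - f i‖ ≤ ρ * B)
    (k : ℕ) (hk : k ≤ N) :
    ‖auxPP f k‖ ≤ B ^ k ∧ ‖auxPP f' k - auxPP f k‖ ≤ k * ρ * (2 * B) ^ k := by
  induction k with
  | zero => simpa [auxPP] using aux_one_norm
  | succ k ih =>
    have hk' : k < N := hk
    obtain ⟨h1, h2⟩ := ih hk'.le
    simp only [auxPP, dif_pos hk']
    exact aux_step_left _ _ _ _ k B ρ hB hρ hρ1 (hf _) h1 (hf' _) h2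

/-- layers have norm at most `B` -/
def auxBdd {n0 nL w L : ℕ} (θ : DLNParams n0 nL w L) (B : ℝ) : Prop :=
  (∀ k, ‖dlnWmid θ k‖ ≤ B) ∧ ∑ i, ∑ j, dlnW1 θ i j ^ 2 ≤ B ^ 2 ∧ ∑ i, ∑ j, dlnWL θ i j ^ 2 ≤ B ^ 2

lemma aux_sum_inj {ι κ : Type*} [Fintype ι] [Fintype κ] (e : κ → ι) (he : Function.Injective e)
    (g : ι → ℝ) (hg : ∀ i, 0 ≤ g i) : ∑ k, g (e k) ≤ ∑ i, g i := by
  classical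
  rw [← Finset.sum_image (s := Finset.univ) (g := e) (f := g) (fun x _ y _ h => he h)]
  exact Finset.sum_le_sum_of_subset_of_nonneg (Finset.subset_univ _) fun i _ _ => hg i

lemma aux_layer_dist {n0 nL w L : ℕ} (θ θ' : DLNParams n0 nL w L) {m n : ℕ}
    (e : Fin m × Fin n → DLNIdx n0 nL w L) (he : Function.Injective e) :
    ‖(Matrix.of fun i j => θ' (e (i, j)) : Matrix (Fin m) (Fin n) ℝ) -
      (Matrix.of fun i j => θ (e (i, j)) : Matrix (Fin m) (Fin n) ℝ)‖ ≤ dlnDist θ θ' := by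
  refine aux_opnorm_frob _ _ (Real.sqrt_nonneg _) ?_
  rw [dlnDist, Real.sq_sqrt (Finset.sum_nonneg fun i _ => sq_nonneg _)]
  have := aux_sum_inj e he (fun i => (θ i - θ' i) ^ 2) fun i => sq_nonneg _
  rw [Fintype.sum_prod_type] at this
  refine le_trans (le_of_eq ?_) this
  refine Finset.sum_congr rfl fun i _ => Finset.sum_congr rfl fun j _ => ?_
  simp only [Matrix.sub_apply, Matrix.of_apply]
  ring

lemma auxH_pert {n0 nL w L : ℕ} (θ θ' : DLNParams n0 nL w L) (B ρ : ℝ) (hB : 0 ≤ B)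
    (hρ : 0 ≤ ρ) (hρ1 : ρ ≤ 1) (hb : auxBdd θ B) (hd : dlnDist θ θ' ≤ ρ * B) :
    ‖auxH θ (L - 2)‖ ≤ B ^ (L - 2 + 1) ∧ ‖auxH θ' (L - 2) - auxH θ (L - 2)‖ ≤
      ((L - 2 + 1 : ℕ) : ℝ) * ρ * (2 * B) ^ (L - 2 + 1) := by
  have hmid : ∀ k, ‖dlnWmid θ' k - dlnWmid θ k‖ ≤ ρ * B := fun k =>
    (aux_layer_dist θ θ' (fun p : Fin w × Fin w => Sum.inr (Sum.inl (k, p.1, p.2)))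
      (fun p q h => by simpa [Prod.ext_iff] using h)).trans hd
  have h1 : ‖dlnW1 θ' - dlnW1 θ‖ ≤ ρ * B :=
    (aux_layer_dist θ θ' (fun p : Fin w × Fin n0 => Sum.inl (p.1, p.2))
      (fun p q h => by simpa [Prod.ext_iff] using h)).trans hd
  obtain ⟨p1, p2⟩ := auxPP_pert (dlnWmid θ) (dlnWmid θ') B ρ hB hρ hρ1 hb.1 hmid (L - 2) le_rfl
  exact aux_step_right _ _ _ _ (L - 2) B ρ hB hρ hρ1 (aux_opnorm_frob _ B hB hb.2.1) p1 h1 p2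

lemma auxA_pert {n0 nL w L : ℕ} (θ θ' : DLNParams n0 nL w L) (B ρ : ℝ) (hB : 0 ≤ B)
    (hρ : 0 ≤ ρ) (hρ1 : ρ ≤ 1) (hb : auxBdd θ B) (hd : dlnDist θ θ' ≤ ρ * B) :
    ‖dlnMatrix θ - dlnMatrix θ'‖ ≤ ((L - 2 + 1 + 1 : ℕ) : ℝ) * ρ * (2 * B) ^ (L - 2 + 1 + 1) := by
  obtain ⟨p1, p2⟩ := auxH_pert θ θ' B ρ hB hρ hρ1 hb hd
  have h1 : ‖dlnWL θ' - dlnWL θ‖ ≤ ρ * B :=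
    (aux_layer_dist θ θ' (fun p : Fin nL × Fin w => Sum.inr (Sum.inr (p.1, p.2)))
      (fun p q h => by simpa [Prod.ext_iff] using h)).trans hd
  have h := (aux_step_left _ _ _ _ (L - 2 + 1) B ρ hB hρ hρ1
    (aux_opnorm_frob _ B hB hb.2.2) p1 h1 p2).2
  have hpos := (norm_nonneg _).trans h
  rw [pi_norm_le_iff_of_nonneg hpos]; intro i
  rw [pi_norm_le_iff_of_nonneg hpos]; intro j
  refine le_trans ?_ h
  refine le_trans (le_of_eq ?_) (aux_entry_le _ i j)
  rw [Pi.sub_apply, Pi.sub_apply, aux_dlnMatrix, aux_dlnMatrix, Real.norm_eq_abs, abs_sub_comm,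
    Matrix.sub_apply]

end

lemma aux_sq_dot {n : Type*} [Fintype n] (x : n → ℝ) : x ⬝ᵥ x = ∑ i, x i ^ 2 := by
  simp [dotProduct, sq]

lemma aux_solve_vec {w n : ℕ} (H : Matrix (Fin w) (Fin n) ℝ) (a : ℝ) (ha : 0 < a)
    (hH : ∀ x : Fin n → ℝ, a ^ 2 * ∑ j, x j ^ 2 ≤ ∑ i, (H.mulVec x i) ^ 2) (d : Fin n → ℝ) :
    ∃ δ : Fin w → ℝ, Matrix.vecMul δ H = d ∧ a ^ 2 * ∑ i, δ i ^ 2 ≤ ∑ j, d j ^ 2 := by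
  have hinj : Function.Injective (Matrix.mulVecLin (H.transpose * H)) := by
    rw [← LinearMap.ker_eq_bot, LinearMap.ker_eq_bot']
    intro z hz
    have h1 : (H.mulVec z) ⬝ᵥ (H.mulVec z) = 0 := by
      rw [Matrix.dotProduct_mulVec, Matrix.vecMul_mulVec]
      have : (H.transpose * H).mulVec z = 0 := hz
      have h3 : Matrix.vecMul z (H.transpose * H) = 0 := by
        rw [← Matrix.mulVec_transpose]; simpa using this
      rw [h3]; simp
    rw [aux_sq_dot] at h1
    have h2 := hH z
    rw [h1] at h2
    have h3 : ∑ j, z j ^ 2 ≤ 0 := by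
      by_contra h
      have : 0 < a ^ 2 * ∑ j, z j ^ 2 := mul_pos (by positivity) (not_le.1 h)
      linarith
    have h4 := (Finset.sum_eq_zero_iff_of_nonneg (fun i _ => sq_nonneg (z i))).1
      (le_antisymm h3 (Finset.sum_nonneg fun i _ => sq_nonneg _))
    funext i
    simpa using h4 i (Finset.mem_univ i)
  obtain ⟨z, hz⟩ := (LinearMap.injective_iff_surjective.1 hinj) d
  have hz' : (H.transpose * H).mulVec z = d := hz
  have hvm : Matrix.vecMul (H.mulVec z) H = d := by
    rw [← hz', ← Matrix.mulVec_transpose, Matrix.mulVec_mulVec]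
  refine ⟨H.mulVec z, hvm, ?_⟩
  have e1 : ∑ i, (H.mulVec z i) ^ 2 = d ⬝ᵥ z := by
    rw [← aux_sq_dot, Matrix.dotProduct_mulVec, hvm]
  have e2 : (∑ j, d j * z j) ^ 2 ≤ (∑ j, d j ^ 2) * ∑ j, z j ^ 2 :=
    Finset.sum_mul_sq_le_sq_mul_sq _ _ _
  have e3 := hH z
  have e4 : d ⬝ᵥ z = ∑ j, d j * z j := rfl
  set q := ∑ i, (H.mulVec z i) ^ 2 with hq
  have q0 : 0 ≤ q := Finset.sum_nonneg fun i _ => sq_nonneg _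
  have d0 : 0 ≤ ∑ j, d j ^ 2 := Finset.sum_nonneg fun i _ => sq_nonneg _
  rw [← e4, ← e1] at e2
  by_cases hq0 : q = 0
  · rw [hq0]; simpa using d0
  · have qp : 0 < q := lt_of_le_of_ne q0 (Ne.symm hq0)
    refine le_of_mul_le_mul_right ?_ qp
    calc a ^ 2 * q * q = a ^ 2 * q ^ 2 := by ring
      _ ≤ a ^ 2 * ((∑ j, d j ^ 2) * ∑ j, z j ^ 2) := by gcongr
      _ = (∑ j, d j ^ 2) * (a ^ 2 * ∑ j, z j ^ 2) := by ring
      _ ≤ (∑ j, d j ^ 2) * q := by gcongr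

lemma aux_solve {w n m : ℕ} (H : Matrix (Fin w) (Fin n) ℝ) (a : ℝ) (ha : 0 < a)
    (hH : ∀ x : Fin n → ℝ, a ^ 2 * ∑ j, x j ^ 2 ≤ ∑ i, (H.mulVec x i) ^ 2)
    (D : Matrix (Fin m) (Fin n) ℝ) :
    ∃ Δ : Matrix (Fin m) (Fin w) ℝ, Δ * H = D ∧
      a ^ 2 * ∑ i, ∑ k, Δ i k ^ 2 ≤ ∑ i, ∑ j, D i j ^ 2 := by
  choose δ h1 h2 using fun i => aux_solve_vec H a ha hH (D i)
  refine ⟨Matrix.of δ, ?_, ?_⟩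
  · ext i j
    have := congrFun (h1 i) j
    rw [← this]; rfl
  · rw [Finset.mul_sum]
    exact Finset.sum_le_sum fun i _ => h2 i

/-- embed a last-layer matrix -/
def auxLast {n0 nL w L : ℕ} (Δ : Matrix (Fin nL) (Fin w) ℝ) : DLNParams n0 nL w L :=
  Sum.elim 0 (Sum.elim 0 fun p => Δ p.1 p.2)

lemma auxLast_H {n0 nL w L : ℕ} (θ : DLNParams n0 nL w L) (Δ : Matrix (Fin nL) (Fin w) ℝ) (t : ℝ)
    (k : ℕ) : auxH (θ + t • auxLast Δ) k = auxH θ k := by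
  have h1 : dlnW1 (θ + t • auxLast Δ) = dlnW1 θ := by
    ext i j; simp [dlnW1, auxLast]
  have h2 : dlnWmid (θ + t • auxLast Δ) = dlnWmid θ := by
    funext k; ext i j; simp [dlnWmid, auxLast]
  rw [auxH, auxH, h1, h2]

lemma auxLast_matrix {n0 nL w L : ℕ} (θ : DLNParams n0 nL w L) (Δ : Matrix (Fin nL) (Fin w) ℝ)
    (t : ℝ) : dlnMatrix (θ + t • auxLast Δ) = dlnMatrix θ + t • (fun i j => (Δ * auxH θ (L - 2)) i j) := by
  have h1 : dlnWL (θ + t • auxLast Δ) = dlnWL θ + t • Δ := by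
    ext i j; simp [dlnWL, auxLast]
  funext i j
  rw [aux_dlnMatrix, auxLast_H, h1, Matrix.add_mul, Matrix.smul_mul]
  simp [aux_dlnMatrix]

lemma aux_dist_nonneg {n0 nL w L : ℕ} (θ θ' : DLNParams n0 nL w L) : 0 ≤ dlnDist θ θ' :=
  Real.sqrt_nonneg _

lemma aux_dm_upper {n0 nL w L : ℕ} (C : (Fin nL → Fin n0 → ℝ) → ℝ) (θ : DLNParams n0 nL w L)
    (a : ℝ) (ha : 0 < a)
    (hH : ∀ x : Fin n0 → ℝ, a ^ 2 * ∑ j, x j ^ 2 ≤ ∑ i, ((auxH θ (L - 2)).mulVec x i) ^ 2)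
    (A : Fin nL → Fin n0 → ℝ) (hA : ∀ B, C A ≤ C B) (T : ℝ) (hT0 : 0 ≤ T)
    (hT : ∑ i, ∑ j, (A i j - dlnMatrix θ i j) ^ 2 ≤ T ^ 2) :
    ∃ θ', DLNIsGlobalMin C θ' ∧ dlnDist θ θ' ≤ T / a := by
  obtain ⟨Δ, h1, h2⟩ := aux_solve (auxH θ (L - 2)) a ha hH
    (Matrix.of fun i j => A i j - dlnMatrix θ i j)
  refine ⟨θ + (1 : ℝ) • auxLast Δ, ?_, ?_⟩
  · intro B
    rw [auxLast_matrix, h1]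
    have : (dlnMatrix θ + (1 : ℝ) • fun i j => (Matrix.of fun i j => A i j - dlnMatrix θ i j) i j)
        = A := by
      funext i j; simp
    rw [this]; exact hA B
  · rw [dlnDist]
    apply Real.sqrt_le_iff.2 ⟨by positivity, ?_⟩
    have : ∑ i, (θ i - (θ + (1 : ℝ) • auxLast Δ : DLNParams n0 nL w L) i) ^ 2 = ∑ i, ∑ k, Δ i k ^ 2 := by
      simp [Fintype.sum_sum_type, auxLast, Fintype.sum_prod_type]
    rw [this, div_pow, le_div_iff₀ (by positivity), mul_comm]
    exact h2.trans hT

lemma aux_right_deriv (g : ℝ → ℝ) (g' : ℝ) (hg : HasDerivAt g g' 0) (c : ℝ)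
    (h : ∀ᶠ t in nhdsWithin (0 : ℝ) (Set.Ioi 0), g 0 + t * c ≤ g t) : c ≤ g' := by
  have h1 := hg.tendsto_slope_zero_right
  refine ge_of_tendsto h1 ?_
  filter_upwards [h, self_mem_nhdsWithin] with t ht ht0
  have ht0' : 0 < t := ht0
  simp only [zero_add, smul_eq_mul]
  rw [inv_mul_eq_div, le_div_iff₀ ht0']
  linarith

lemma aux_crit_min {E : Type*} [NormedAddCommGroup E] [NormedSpace ℝ E] (C : E → ℝ)
    (hconv : ConvexOn ℝ Set.univ C) (hdiff : Differentiable ℝ C) (A : E)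
    (hA : fderiv ℝ C A = 0) (B : E) : C A ≤ C B := by
  have hd : HasDerivAt (fun t : ℝ => -C (A + t • (B - A))) 0 0 := by
    have h1 : HasDerivAt (fun t : ℝ => A + t • (B - A)) (B - A) 0 := by
      simpa using ((hasDerivAt_id (0 : ℝ)).smul_const (B - A)).const_add A
    have h2 : HasFDerivAt C (fderiv ℝ C A) (A + (0 : ℝ) • (B - A)) := by
      simpa using (hdiff A).hasFDerivAt
    have h3 := h2.comp_hasDerivAt (0 : ℝ) h1
    rw [hA] at h3
    have h4 := h3.neg
    rw [ContinuousLinearMap.zero_apply, neg_zero] at h4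
    exact h4
  have h := aux_right_deriv _ _ hd (C A - C B) ?_
  · linarith
  · have : ∀ᶠ t : ℝ in nhdsWithin (0 : ℝ) (Set.Ioi 0), t < 1 :=
      nhdsWithin_le_nhds (Iio_mem_nhds one_pos)
    filter_upwards [this, self_mem_nhdsWithin] with t ht1 ht0
    have ht0' : 0 < t := ht0
    have := hconv.2 (Set.mem_univ A) (Set.mem_univ B) (by linarith : 0 ≤ 1 - t) ht0'.le (by ring)
    have he : (1 - t) • A + t • B = A + t • (B - A) := by
      rw [smul_sub, sub_smul, one_smul]; abel
    rw [he] at this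
    simp only [smul_eq_mul, zero_smul, add_zero] at this ⊢
    nlinarith

lemma aux_not_saddle {n0 nL w L : ℕ} (C : (Fin nL → Fin n0 → ℝ) → ℝ)
    (hconv : ConvexOn ℝ Set.univ C) (hdiff : Differentiable ℝ C) (θ : DLNParams n0 nL w L)
    (a : ℝ) (ha : 0 < a)
    (hH : ∀ x : Fin n0 → ℝ, a ^ 2 * ∑ j, x j ^ 2 ≤ ∑ i, ((auxH θ (L - 2)).mulVec x i) ^ 2) :
    ¬ DLNIsSaddle C θ := by
  rintro ⟨h1, h2⟩
  apply h2
  have hcrit : fderiv ℝ C (dlnMatrix θ) = 0 := by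
    ext D
    obtain ⟨Δ, hΔ, -⟩ := aux_solve (auxH θ (L - 2)) a ha hH (Matrix.of D)
    have hline : HasDerivAt (fun t : ℝ => θ + t • auxLast Δ) (auxLast Δ) 0 := by
      simpa using ((hasDerivAt_id (0 : ℝ)).smul_const
        (auxLast Δ : DLNParams n0 nL w L)).const_add θ
    have hl : HasFDerivAt (dlnLoss C) (fderiv ℝ (dlnLoss C) θ) (θ + (0 : ℝ) • auxLast Δ) := by
      have : DifferentiableAt ℝ (dlnLoss C) θ := (hdiff _).comp θ (aux_dlnMatrix_diff θ)
      simpa using this.hasFDerivAt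
    have d1 := hl.comp_hasDerivAt (0 : ℝ) hline
    rw [h1] at d1
    have hlineA : HasDerivAt (fun t : ℝ => dlnMatrix θ + t • D) D 0 := by
      simpa using ((hasDerivAt_id (0 : ℝ)).smul_const D).const_add (dlnMatrix θ)
    have hC : HasFDerivAt C (fderiv ℝ C (dlnMatrix θ)) (dlnMatrix θ + (0 : ℝ) • D) := by
      simpa using (hdiff _).hasFDerivAt
    have d2 := hC.comp_hasDerivAt (0 : ℝ) hlineA
    have heq : (dlnLoss C ∘ fun t : ℝ => θ + t • auxLast Δ) = C ∘ fun t : ℝ => dlnMatrix θ + t • D := by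
      funext t
      simp only [Function.comp, dlnLoss, auxLast_matrix, hΔ]
      rfl
    rw [heq] at d1
    have := d2.unique d1
    simpa using this
  exact Filter.Eventually.of_forall fun θ' => aux_crit_min C hconv hdiff _ hcrit _

/-- zero out the first and last layers -/
def auxZero {n0 nL w L : ℕ} (θ : DLNParams n0 nL w L) : DLNParams n0 nL w L :=
  Sum.elim 0 (Sum.elim (fun p => θ (Sum.inr (Sum.inl p))) 0)

lemma auxZero_dist {n0 nL w L : ℕ} (θ : DLNParams n0 nL w L) (B : ℝ) (hB : 0 ≤ B)
    (hb : auxBdd θ B) : dlnDist θ (auxZero θ) ≤ 2 * B := by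
  rw [dlnDist]
  apply Real.sqrt_le_iff.2 ⟨by positivity, ?_⟩
  have h1 := hb.2.1
  have h2 := hb.2.2
  simp only [dlnW1, dlnWL, Matrix.of_apply] at h1 h2
  simp only [Fintype.sum_sum_type, auxZero, Fintype.sum_prod_type, Sum.elim_inl, Sum.elim_inr,
    Pi.zero_apply, sub_zero, sub_self]
  simp only [ne_eq, OfNat.ofNat_ne_zero, not_false_eq_true, zero_pow, Finset.sum_const_zero, zero_add]
  nlinarith

lemma auxZero_saddle {n0 nL w L : ℕ} (C : (Fin nL → Fin n0 → ℝ) → ℝ)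
    (hconv : ConvexOn ℝ Set.univ C) (hdiff : Differentiable ℝ C)
    (h0 : ¬ (∀ B, C (0 : Fin nL → Fin n0 → ℝ) ≤ C B)) (θ : DLNParams n0 nL w L)
    (hH : auxH θ (L - 2) ≠ 0) : DLNIsSaddle C (auxZero θ) := by
  set M := auxPP (dlnWmid θ) (L - 2) with hM
  have hM0 : M ≠ 0 := by
    rintro h; apply hH; rw [auxH, ← hM, h, Matrix.zero_mul]
  obtain ⟨k, l, hkl⟩ : ∃ k l, M k l ≠ 0 := by
    by_contra! h; exact hM0 (by ext k l; simpa using h k l)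
  have hW1 : dlnW1 (auxZero θ) = 0 := by ext i j; simp [dlnW1, auxZero]
  have hWL : dlnWL (auxZero θ) = 0 := by ext i j; simp [dlnWL, auxZero]
  have hmat0 : dlnMatrix (auxZero θ) = 0 := by
    funext i j; rw [aux_dlnMatrix, hWL, Matrix.zero_mul]; rfl
  constructor
  · have hA : HasFDerivAt (fun θ : DLNParams n0 nL w L => dlnMatrix θ)
      (0 : DLNParams n0 nL w L →L[ℝ] (Fin nL → Fin n0 → ℝ)) (auxZero θ) := by
      have hz : ∀ i j, HasFDerivAt (fun θ : DLNParams n0 nL w L => dlnMatrix θ i j)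
          (0 : DLNParams n0 nL w L →L[ℝ] ℝ) (auxZero θ) := by
        intro i j
        simp only [aux_dlnMatrix, Matrix.mul_apply]
        have : (0 : DLNParams n0 nL w L →L[ℝ] ℝ) = ∑ k : Fin w, 0 := by simp
        rw [this]
        refine HasFDerivAt.fun_sum fun q _ => ?_
        have f1 : DifferentiableAt ℝ (fun θ : DLNParams n0 nL w L => dlnWL θ i q) (auxZero θ) := by
          simp only [dlnWL, Matrix.of_apply]; fun_prop
        have f2 := auxH_diff (n0 := n0) (nL := nL) (w := w) (L := L) (L - 2) q j (auxZero θ)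
        have f3 := f1.hasFDerivAt.mul f2.hasFDerivAt
        have g1 : dlnWL (auxZero θ) i q = 0 := by rw [hWL]; rfl
        have g2 : auxH (auxZero θ) (L - 2) q j = 0 := by rw [auxH, hW1, Matrix.mul_zero]; rfl
        rw [g1, g2, zero_smul, zero_smul, add_zero] at f3
        exact f3
      refine hasFDerivAt_pi'' fun i => ?_
      refine hasFDerivAt_pi'' fun j => ?_
      exact hz i j
    have hC := (hdiff (dlnMatrix (auxZero θ))).hasFDerivAt
    have := hC.comp (auxZero θ) hA
    rw [ContinuousLinearMap.comp_zero] at this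
    exact this.fderiv
  · intro hmin
    have hder : fderiv ℝ C 0 ≠ 0 := fun h => h0 (aux_crit_min C hconv hdiff 0 h)
    obtain ⟨i, j, hij⟩ : ∃ i j, fderiv ℝ C 0 (Pi.single i (Pi.single j 1)) ≠ 0 := by
      by_contra! h
      apply hder
      ext D
      have : D = ∑ i, ∑ j, D i j • (Pi.single i (Pi.single j 1) : Fin nL → Fin n0 → ℝ) := by
        funext a b
        simp [Finset.sum_apply, Pi.single_apply, ite_apply]
      rw [this, map_sum]
      simp [h]
    set d := fderiv ℝ C 0 (Pi.single i (Pi.single j 1)) with hd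
    set η : ℝ := -d / M k l with hη
    set curve : ℝ → DLNParams n0 nL w L := fun t =>
      Sum.elim (fun p => if p = (l, j) then Real.sqrt t else 0)
        (Sum.elim (fun p => θ (Sum.inr (Sum.inl p)))
          (fun p => if p = (i, k) then η * Real.sqrt t else 0)) with hcurve
    have hc0 : curve 0 = auxZero θ := by
      funext p
      rcases p with p | p | p <;> simp [hcurve, auxZero]
    have hcc : Continuous curve := by
      refine continuous_pi fun p => ?_
      rcases p with p | p | p
      · simp only [hcurve, Sum.elim_inl]; split_ifs <;> fun_prop
      · simp only [hcurve, Sum.elim_inl, Sum.elim_inr]; fun_prop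
      · simp only [hcurve, Sum.elim_inr]; split_ifs <;> fun_prop
    have hcm : ∀ t : ℝ, 0 ≤ t → dlnMatrix (curve t)
        = t • (-d) • (Pi.single i (Pi.single j 1) : Fin nL → Fin n0 → ℝ) := by
      intro t ht
      have e1 : dlnWmid (curve t) = dlnWmid θ := by
        funext k; ext a b; simp [dlnWmid, hcurve]
      have e2 : dlnW1 (curve t) = Matrix.single l j (Real.sqrt t) := by
        ext a b
        simp only [dlnW1, hcurve, Matrix.of_apply, Sum.elim_inl, Matrix.single_apply, Prod.mk.injEq]
        congr 1; simp [eq_comm]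
      have e3 : dlnWL (curve t) = Matrix.single i k (η * Real.sqrt t) := by
        ext a b
        simp only [dlnWL, hcurve, Matrix.of_apply, Sum.elim_inr, Matrix.single_apply, Prod.mk.injEq]
        congr 1; simp [eq_comm]
      funext a b
      rw [aux_dlnMatrix, auxH, e1, ← hM, e2, e3, ← Matrix.mul_assoc, Matrix.single_mul_mul_single]
      simp only [Matrix.single_apply, Pi.smul_apply, Pi.single_apply, smul_eq_mul, ite_apply]
      by_cases ha : a = i
      · by_cases hb : b = j
        · subst ha hb
          simp only [and_self, if_true]
          have := Real.mul_self_sqrt ht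
          calc η * Real.sqrt t * M k l * Real.sqrt t = η * M k l * (Real.sqrt t * Real.sqrt t) := by ring
            _ = t * (-d * 1) := by rw [this, hη]; field_simp
        · simp [ha, hb, Ne.symm hb]
      · simp [ha, Ne.symm ha]
    have hev : ∀ᶠ t in nhds (0 : ℝ), dlnLoss C (auxZero θ) ≤ dlnLoss C (curve t) := by
      have : Filter.Tendsto curve (nhds 0) (nhds (auxZero θ)) := by
        rw [← hc0]; exact hcc.continuousAt
      exact this.eventually hmin
    have hline : HasDerivAt (fun t : ℝ => C (t • (-d) • (Pi.single i (Pi.single j 1) :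
        Fin nL → Fin n0 → ℝ))) (-d * d) 0 := by
      have h1 : HasDerivAt (fun t : ℝ => t • (-d) • (Pi.single i (Pi.single j 1) :
        Fin nL → Fin n0 → ℝ)) ((-d) • (Pi.single i (Pi.single j 1) : Fin nL → Fin n0 → ℝ)) 0 := by
        simpa using (hasDerivAt_id (0 : ℝ)).smul_const
          ((-d) • (Pi.single i (Pi.single j 1) : Fin nL → Fin n0 → ℝ))
      have h2 : HasFDerivAt C (fderiv ℝ C 0) ((0 : ℝ) • (-d) • (Pi.single i (Pi.single j 1) :
        Fin nL → Fin n0 → ℝ)) := by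
        rw [zero_smul]; exact (hdiff 0).hasFDerivAt
      have h3 := h2.comp_hasDerivAt (0 : ℝ) h1
      rw [map_smul, ← hd] at h3
      exact h3
    have h := aux_right_deriv _ _ hline 0 ?_
    · have : 0 < d * d := mul_self_pos.2 hij
      linarith
    · filter_upwards [nhdsWithin_le_nhds hev, self_mem_nhdsWithin] with t ht ht0
      have ht0' : 0 < t := ht0
      rw [dlnLoss, dlnLoss, hmat0, hcm t ht0'.le] at ht
      simpa using ht

lemma auxOver_apply {ι κ : Type*} (e : κ → ι) (he : Function.Injective e) (θ : ι → ℝ) (ξ : κ → ℝ)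
    (k : κ) : auxOver e θ ξ (e k) = ξ k := he.extend_apply _ _ _

lemma auxOver_not {ι κ : Type*} (e : κ → ι) (θ : ι → ℝ) (ξ : κ → ℝ)
    (i : ι) (h : ∀ k, e k ≠ i) : auxOver e θ ξ i = θ i :=
  Function.extend_apply' _ _ _ (by rintro ⟨k, hk⟩; exact h k hk)

/-- the index embeddings of the layers -/
def auxE1 (n0 nL w L : ℕ) : Fin w × Fin n0 → DLNIdx n0 nL w L := fun p => Sum.inl p

/-- hidden layers -/
def auxEm (n0 nL w L : ℕ) (k : Fin (L - 2)) : Fin w × Fin w → DLNIdx n0 nL w L :=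
  fun p => Sum.inr (Sum.inl (k, p.1, p.2))

/-- last layer -/
def auxEL (n0 nL w L : ℕ) : Fin nL × Fin w → DLNIdx n0 nL w L := fun p => Sum.inr (Sum.inr p)

lemma auxE1_inj (n0 nL w L : ℕ) : Function.Injective (auxE1 n0 nL w L) := by
  intro p q h; simpa [auxE1] using h

lemma auxEm_inj (n0 nL w L : ℕ) (k : Fin (L - 2)) : Function.Injective (auxEm n0 nL w L k) := by
  intro p q h; simpa [auxEm, Prod.ext_iff] using h

lemma auxEL_inj (n0 nL w L : ℕ) : Function.Injective (auxEL n0 nL w L) := by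
  intro p q h; simpa [auxEL] using h

section
variable {n0 nL w L : ℕ}

lemma auxOver1_W1 (θ : DLNParams n0 nL w L) (ξ : Fin w × Fin n0 → ℝ) :
    dlnW1 (auxOver (auxE1 n0 nL w L) θ ξ) = Matrix.of fun i j => ξ (i, j) := by
  ext i j
  exact auxOver_apply _ (auxE1_inj n0 nL w L) θ ξ (i, j)

lemma auxOverm_mid (θ : DLNParams n0 nL w L) (k : Fin (L - 2)) (ξ : Fin w × Fin w → ℝ) :
    dlnWmid (auxOver (auxEm n0 nL w L k) θ ξ) k = Matrix.of fun i j => ξ (i, j) := by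
  ext i j
  exact auxOver_apply _ (auxEm_inj n0 nL w L k) θ ξ (i, j)

lemma auxOverm_mid_ne (θ : DLNParams n0 nL w L) (k l : Fin (L - 2)) (hkl : k ≠ l)
    (ξ : Fin w × Fin w → ℝ) :
    dlnWmid (auxOver (auxEm n0 nL w L k) θ ξ) l = dlnWmid θ l := by
  ext i j
  exact auxOver_not _ θ ξ _ (by intro p; simp [auxEm, hkl])

lemma auxOverm_W1 (θ : DLNParams n0 nL w L) (k : Fin (L - 2)) (ξ : Fin w × Fin w → ℝ) :
    dlnW1 (auxOver (auxEm n0 nL w L k) θ ξ) = dlnW1 θ := by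
  ext i j
  exact auxOver_not _ θ ξ _ (by intro p; simp [auxEm])

lemma auxOverL_WL (θ : DLNParams n0 nL w L) (ξ : Fin nL × Fin w → ℝ) :
    dlnWL (auxOver (auxEL n0 nL w L) θ ξ) = Matrix.of fun i j => ξ (i, j) := by
  ext i j
  exact auxOver_apply _ (auxEL_inj n0 nL w L) θ ξ (i, j)

lemma auxOverL_H (θ : DLNParams n0 nL w L) (ξ : Fin nL × Fin w → ℝ) (k : ℕ) :
    auxH (auxOver (auxEL n0 nL w L) θ ξ) k = auxH θ k := by
  have h1 : dlnW1 (auxOver (auxEL n0 nL w L) θ ξ) = dlnW1 θ := by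
    ext i j
    exact auxOver_not _ θ ξ _ (by intro p; simp [auxEL])
  have h2 : dlnWmid (auxOver (auxEL n0 nL w L) θ ξ) = dlnWmid θ := by
    funext k; ext i j
    exact auxOver_not _ θ ξ _ (by intro p; simp [auxEL])
  rw [auxH, auxH, h1, h2]

lemma auxPP_congr {R : Type*} [Monoid R] {N : ℕ} (f g : Fin N → R) (k : ℕ)
    (h : ∀ i : Fin N, (i : ℕ) < k → f i = g i) : auxPP f k = auxPP g k := by
  induction k with
  | zero => rfl
  | succ k ih =>
    rw [auxPP, auxPP, ih fun i hi => h i (by omega)]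
    split_ifs with hk
    · rw [h ⟨k, hk⟩ (by simp)]
    · rfl

lemma auxOverm_H (θ : DLNParams n0 nL w L) (k : Fin (L - 2)) (ξ : Fin w × Fin w → ℝ) :
    auxH (auxOver (auxEm n0 nL w L k) θ ξ) k = auxH θ k := by
  rw [auxH, auxH, auxOverm_W1]
  congr 1
  apply auxPP_congr
  intro i hi
  apply auxOverm_mid_ne
  intro h; rw [h] at hi; exact lt_irrefl _ hi

lemma auxH_succ (θ : DLNParams n0 nL w L) (k : Fin (L - 2)) :
    auxH θ (k + 1) = dlnWmid θ k * auxH θ k := by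
  rw [auxH, auxPP, dif_pos k.2, auxH, Matrix.mul_assoc]

lemma auxHvec_meas (k : ℕ) (x : Fin n0 → ℝ) (i : Fin w) :
    Measurable (fun θ : DLNParams n0 nL w L => (auxH θ k).mulVec x i) := by
  simp only [Matrix.mulVec, dotProduct]
  refine Finset.measurable_fun_sum _ fun j _ => ?_
  exact (auxH_diff k i j).continuous.measurable.mul_const _

lemma auxHvec_sq_meas (k : ℕ) (x : Fin n0 → ℝ) :
    Measurable (fun θ : DLNParams n0 nL w L => ∑ i, ((auxH θ k).mulVec x i) ^ 2) :=
  Finset.measurable_fun_sum _ fun i _ => (auxHvec_meas k x i).pow_const 2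

lemma auxF_vec0 (v : NNReal) (hv : v ≠ 0) (x : Fin n0 → ℝ) :
    (Measure.pi fun _ : DLNIdx n0 nL w L => gaussianReal 0 v)
      {θ : DLNParams n0 nL w L | ∑ i, ((auxH θ 0).mulVec x i) ^ 2 < w * v / 4 * ∑ j, x j ^ 2}
      ≤ ENNReal.ofReal ((3 / 4) ^ w) := by
  refine aux_resample (auxE1 n0 nL w L) (auxE1_inj n0 nL w L) _ _
    (measurableSet_lt (auxHvec_sq_meas 0 x) measurable_const) _ fun θ => ?_
  refine le_trans (le_of_eq ?_) (aux_matvec_small_ball w v hv x)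
  congr 1
  ext ξ
  simp only [Set.mem_ofPred_eq, auxH, auxPP, auxOver1_W1, Matrix.one_mul]
  rfl

lemma auxF_vecs (v : NNReal) (hv : v ≠ 0) (x : Fin n0 → ℝ) (k : Fin (L - 2)) :
    (Measure.pi fun _ : DLNIdx n0 nL w L => gaussianReal 0 v)
      {θ : DLNParams n0 nL w L | ∑ i, ((auxH θ (k + 1)).mulVec x i) ^ 2 <
        w * v / 4 * ∑ j, ((auxH θ k).mulVec x j) ^ 2}
      ≤ ENNReal.ofReal ((3 / 4) ^ w) := by
  refine aux_resample (auxEm n0 nL w L k) (auxEm_inj n0 nL w L k) _ _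
    (measurableSet_lt (auxHvec_sq_meas _ x) ((auxHvec_sq_meas _ x).const_mul _)) _ fun θ => ?_
  refine le_trans (le_of_eq ?_) (aux_matvec_small_ball w v hv ((auxH θ k).mulVec x))
  congr 1
  ext ξ
  simp only [Set.mem_ofPred_eq, auxH_succ, auxOverm_H, auxOverm_mid, ← Matrix.mulVec_mulVec]
  rfl

lemma auxF_vec (v : NNReal) (hv : v ≠ 0) (x : Fin n0 → ℝ) (k : ℕ) (hk : k ≤ L - 2) :
    (Measure.pi fun _ : DLNIdx n0 nL w L => gaussianReal 0 v)
      {θ : DLNParams n0 nL w L | ∑ i, ((auxH θ k).mulVec x i) ^ 2 <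
        (w * v / 4) ^ (k + 1) * ∑ j, x j ^ 2}
      ≤ ((k + 1 : ℕ) : ENNReal) * ENNReal.ofReal ((3 / 4) ^ w) := by
  induction k with
  | zero => simpa using auxF_vec0 (nL := nL) (L := L) v hv x
  | succ k ih =>
    have h1 := ih (by omega)
    have h2 := auxF_vecs (n0 := n0) (nL := nL) (w := w) v hv x (⟨k, hk⟩ : Fin (L - 2))
    have h0 : (0 : ℝ) ≤ w * v / 4 := by positivity
    refine (measure_mono (t := _ ∪ _) ?_).trans ((measure_union_le _ _).trans
      ((add_le_add h1 h2).trans (le_of_eq ?_)))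
    · intro θ hθ
      by_contra hn
      simp only [Set.mem_union, Set.mem_ofPred_eq, not_or, not_lt] at hn hθ
      have := mul_le_mul_of_nonneg_left hn.1 h0
      have h3 := this.trans hn.2
      rw [← mul_assoc, ← pow_succ'] at h3
      exact absurd hθ (not_lt.2 h3)
    · push_cast; ring

lemma auxF_W1 (v : NNReal) (T : ℝ) (hT : 0 < T) :
    (Measure.pi fun _ : DLNIdx n0 nL w L => gaussianReal 0 v)
      {θ : DLNParams n0 nL w L | T < ∑ i, ∑ j, dlnW1 θ i j ^ 2}
      ≤ ENNReal.ofReal (n0 * (w * v) / T) := by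
  refine aux_resample (auxE1 n0 nL w L) (auxE1_inj n0 nL w L) _ _ ?_ _ fun θ => ?_
  · refine measurableSet_lt measurable_const ?_
    simp only [dlnW1, Matrix.of_apply]; fun_prop
  · refine le_trans (le_of_eq ?_) ((aux_frob (κ := Fin w × Fin n0) v T hT).trans (le_of_eq ?_))
    · congr 1
      ext ξ
      simp only [Set.mem_ofPred_eq, auxOver1_W1, Matrix.of_apply, Fintype.sum_prod_type]
    · congr 2; simp; ring

lemma auxF_WL (v : NNReal) (T : ℝ) (hT : 0 < T) :
    (Measure.pi fun _ : DLNIdx n0 nL w L => gaussianReal 0 v)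
      {θ : DLNParams n0 nL w L | T < ∑ i, ∑ j, dlnWL θ i j ^ 2}
      ≤ ENNReal.ofReal (nL * (w * v) / T) := by
  refine aux_resample (auxEL n0 nL w L) (auxEL_inj n0 nL w L) _ _ ?_ _ fun θ => ?_
  · refine measurableSet_lt measurable_const ?_
    simp only [dlnWL, Matrix.of_apply]; fun_prop
  · refine le_trans (le_of_eq ?_) ((aux_frob (κ := Fin nL × Fin w) v T hT).trans (le_of_eq ?_))
    · congr 1
      ext ξ
      simp only [Set.mem_ofPred_eq, auxOverL_WL, Matrix.of_apply, Fintype.sum_prod_type]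
    · congr 2; simp; ring

lemma auxF_linform (θ : DLNParams n0 nL w L) (F : Fin nL → Fin n0 → ℝ) :
    ∑ i, ∑ j, F i j * dlnMatrix θ i j =
      ∑ p : Fin nL × Fin w, ((auxH θ (L - 2)).mulVec (F p.1) p.2) * dlnWL θ p.1 p.2 := by
  rw [Fintype.sum_prod_type]
  refine Finset.sum_congr rfl fun i _ => ?_
  simp only [aux_dlnMatrix, Matrix.mul_apply, Matrix.mulVec, dotProduct, Finset.mul_sum,
    Finset.sum_mul]
  rw [Finset.sum_comm]
  refine Finset.sum_congr rfl fun i _ => Finset.sum_congr rfl fun j _ => ?_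
  ring

lemma auxF_lin_meas (F : Fin nL → Fin n0 → ℝ) :
    Measurable (fun θ : DLNParams n0 nL w L => ∑ i, ∑ j, F i j * dlnMatrix θ i j) := by
  have h := (aux_dlnMatrix_diff (n0 := n0) (nL := nL) (w := w) (L := L)).continuous
  have : ∀ i j, Continuous (fun θ : DLNParams n0 nL w L => dlnMatrix θ i j) := fun i j =>
    (continuous_apply j).comp ((continuous_apply i).comp h)
  refine Continuous.measurable ?_
  fun_prop

lemma auxF_coef_meas (F : Fin nL → Fin n0 → ℝ) :
    Measurable (fun θ : DLNParams n0 nL w L =>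
      ∑ p : Fin nL × Fin w, ((auxH θ (L - 2)).mulVec (F p.1) p.2) ^ 2) :=
  Finset.measurable_fun_sum _ fun p _ => (auxHvec_meas _ (F p.1) p.2).pow_const 2

lemma auxF_upper (v : NNReal) (F : Fin nL → Fin n0 → ℝ) (h T : ℝ) (hT : 0 < T) :
    (Measure.pi fun _ : DLNIdx n0 nL w L => gaussianReal 0 v)
      {θ : DLNParams n0 nL w L |
        ∑ p : Fin nL × Fin w, ((auxH θ (L - 2)).mulVec (F p.1) p.2) ^ 2 ≤ h ∧
        T < (∑ i, ∑ j, F i j * dlnMatrix θ i j) ^ 2} ≤ ENNReal.ofReal (h * v / T) := by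
  refine aux_resample (auxEL n0 nL w L) (auxEL_inj n0 nL w L) _ _
    ((measurableSet_le (auxF_coef_meas F) measurable_const).inter
      (measurableSet_lt measurable_const ((auxF_lin_meas F).pow_const 2))) _ fun θ => ?_
  by_cases hh : ∑ p : Fin nL × Fin w, ((auxH θ (L - 2)).mulVec (F p.1) p.2) ^ 2 ≤ h
  · refine (measure_mono ?_).trans ((aux_lin_upper v
      (fun p : Fin nL × Fin w => (auxH θ (L - 2)).mulVec (F p.1) p.2) T hT).trans
      (ENNReal.ofReal_le_ofReal ?_))
    · intro ξ hξ
      have h2 := hξ.2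
      simp only [Set.mem_ofPred_eq, auxF_linform, auxOverL_H, auxOverL_WL, Matrix.of_apply] at h2
      exact h2
    · gcongr
  · refine (measure_mono (t := ∅) ?_).trans (by simp)
    intro ξ hξ
    have h2 := hξ.1
    simp only [Set.mem_ofPred_eq, auxOverL_H] at h2
    exact hh h2

lemma auxF_lower (v : NNReal) (F : Fin nL → Fin n0 → ℝ) (b δ c : ℝ) (hc : 0 < c) :
    (Measure.pi fun _ : DLNIdx n0 nL w L => gaussianReal 0 v)
      {θ : DLNParams n0 nL w L |
        c ^ 2 ≤ (∑ p : Fin nL × Fin w, ((auxH θ (L - 2)).mulVec (F p.1) p.2) ^ 2) * v ∧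
        |(∑ i, ∑ j, F i j * dlnMatrix θ i j) - b| ≤ δ} ≤ ENNReal.ofReal (2 * δ / c) := by
  have hm : Measurable (fun θ : DLNParams n0 nL w L =>
      |(∑ i, ∑ j, F i j * dlnMatrix θ i j) - b|) :=
    continuous_abs.measurable.comp ((auxF_lin_meas F).sub_const b)
  refine aux_resample (auxEL n0 nL w L) (auxEL_inj n0 nL w L) _ _
    ((measurableSet_le measurable_const ((auxF_coef_meas F).mul_const _)).inter
      (measurableSet_le hm measurable_const)) _ fun θ => ?_
  by_cases hh : c ^ 2 ≤ (∑ p : Fin nL × Fin w, ((auxH θ (L - 2)).mulVec (F p.1) p.2) ^ 2) * v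
  · refine (measure_mono ?_).trans (aux_lin_lower v
      (fun p : Fin nL × Fin w => (auxH θ (L - 2)).mulVec (F p.1) p.2) b δ c hc hh)
    intro ξ hξ
    have h2 := hξ.2
    simp only [Set.mem_ofPred_eq, auxF_linform, auxOverL_H, auxOverL_WL, Matrix.of_apply] at h2
    exact h2
  · refine (measure_mono (t := ∅) ?_).trans (by simp)
    intro ξ hξ
    have h2 := hξ.1
    simp only [Set.mem_ofPred_eq, auxOverL_H] at h2
    exact hh h2

end

section
open scoped Matrix.Norms.L2Operator
variable {n0 nL w L : ℕ}

lemma auxF_mid (hw : 0 < w) (v : NNReal) (s : ℝ) (hs : 0 < s) (hsv : s ^ 2 = w * v)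
    (k : Fin (L - 2)) :
    (Measure.pi fun _ : DLNIdx n0 nL w L => gaussianReal 0 v)
      {θ : DLNParams n0 nL w L | 56 * s < ‖dlnWmid θ k‖} ≤ ENNReal.ofReal ((3 / 4) ^ w) := by
  refine aux_resample (auxEm n0 nL w L k) (auxEm_inj n0 nL w L k) _ _ ?_ _ fun θ => ?_
  · refine measurableSet_lt measurable_const ?_
    refine Continuous.measurable (Continuous.norm ?_)
    refine continuous_matrix fun i j => ?_
    simp only [dlnWmid, Matrix.of_apply]; fun_prop
  · refine le_trans (le_of_eq ?_) (aux_opnorm_prob w hw v s hs hsv)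
    congr 1
    ext ξ
    simp only [Set.mem_ofPred_eq, auxOverm_mid]

end

/-- typical layer norm -/
def auxS (γ : ℝ) (w : ℕ) : ℝ := (w : ℝ) ^ ((1 - γ) / 2)

lemma auxS_pos (γ : ℝ) (w : ℕ) (hw : 1 ≤ w) : 0 < auxS γ w :=
  Real.rpow_pos_of_pos (by exact_mod_cast hw) _

lemma auxS_one (γ : ℝ) (hγ : γ < 1) (w : ℕ) (hw : 1 ≤ w) : 1 ≤ auxS γ w :=
  Real.one_le_rpow (by exact_mod_cast hw) (by linarith)

lemma auxV_coe (γ : ℝ) (w : ℕ) :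
    ((Real.toNNReal ((w : ℝ) ^ (-γ)) : NNReal) : ℝ) = (w : ℝ) ^ (-γ) :=
  Real.coe_toNNReal _ (Real.rpow_nonneg (Nat.cast_nonneg w) _)

lemma auxV_ne (γ : ℝ) (w : ℕ) (hw : 1 ≤ w) : Real.toNNReal ((w : ℝ) ^ (-γ)) ≠ 0 := by
  have : (0 : ℝ) < (w : ℝ) ^ (-γ) := Real.rpow_pos_of_pos (by exact_mod_cast hw) _
  simpa using this

lemma auxS_sq (γ : ℝ) (w : ℕ) (hw : 1 ≤ w) :
    auxS γ w ^ 2 = w * (Real.toNNReal ((w : ℝ) ^ (-γ)) : NNReal) := by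
  have hw' : (0 : ℝ) < w := by exact_mod_cast hw
  rw [auxV_coe, auxS, ← Real.rpow_natCast, ← Real.rpow_mul hw'.le]
  nth_rewrite 2 [← Real.rpow_one (w : ℝ)]
  rw [← Real.rpow_add hw']
  congr 1; push_cast; ring

lemma auxS_total (γ : ℝ) (L : ℕ) (hL : 2 ≤ L) (w : ℕ) (hw : 1 ≤ w) :
    (w : ℝ) ^ (-γ) * (auxS γ w ^ (L - 2 + 1)) ^ 2 = (w : ℝ) ^ ((1 - γ) * L - 1) := by
  have hw' : (0 : ℝ) < w := by exact_mod_cast hw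
  rw [auxS, ← Real.rpow_natCast, ← Real.rpow_natCast, ← Real.rpow_mul hw'.le,
    ← Real.rpow_mul hw'.le, ← Real.rpow_add hw']
  congr 1
  have : ((L - 2 + 1 : ℕ) : ℝ) = (L : ℝ) - 1 := by
    push_cast [Nat.cast_sub hL]; ring
  rw [this]; push_cast; ring

lemma auxS_inv (γ : ℝ) (L : ℕ) (hL : 2 ≤ L) (w : ℕ) (hw : 1 ≤ w) :
    (w : ℝ) ^ (-((1 - γ) * ((L : ℝ) - 1)) / 2) = (auxS γ w ^ (L - 2 + 1))⁻¹ := by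
  have hw' : (0 : ℝ) < w := by exact_mod_cast hw
  rw [auxS, ← Real.rpow_natCast, ← Real.rpow_mul hw'.le, ← Real.rpow_neg hw'.le]
  congr 1
  have : ((L - 2 + 1 : ℕ) : ℝ) = (L : ℝ) - 1 := by
    push_cast [Nat.cast_sub hL]; ring
  rw [this]; ring

lemma aux_exp_nonpos (γ : ℝ) (L : ℕ) (hL : 2 ≤ L) (hγ1 : 1 - 1 / (L : ℝ) ≤ γ) :
    (1 - γ) * L - 1 ≤ 0 := by
  have hL' : (0 : ℝ) < L := by positivity
  have : (1 - γ) ≤ 1 / (L : ℝ) := by linarith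
  rw [le_div_iff₀ hL'] at this
  linarith

/-- the event `P` fails with probability at most `ε`, for large width -/
def auxTail (L n0 nL : ℕ) (γ ε : ℝ) (P : ∀ w : ℕ, DLNParams n0 nL w L → Prop) : Prop :=
  ∃ w₀ : ℕ, ∀ w : ℕ, w₀ ≤ w →
    dlnGauss n0 nL w L ((w : ℝ) ^ (-γ)) {θ | ¬ P w θ} ≤ ENNReal.ofReal ε

section
open scoped Matrix.Norms.L2Operator
variable {L n0 nL : ℕ} {γ : ℝ}

/-- the operator norm, as a plain function -/
def auxOpN {m n : ℕ} (A : Matrix (Fin m) (Fin n) ℝ) : ℝ := ‖A‖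

lemma auxTail_and {ε₁ ε₂ : ℝ} (h₁ : 0 ≤ ε₁) (h₂ : 0 ≤ ε₂)
    {P Q : ∀ w : ℕ, DLNParams n0 nL w L → Prop}
    (hP : auxTail L n0 nL γ ε₁ P) (hQ : auxTail L n0 nL γ ε₂ Q) :
    auxTail L n0 nL γ (ε₁ + ε₂) fun w θ => P w θ ∧ Q w θ := by
  obtain ⟨w1, h1⟩ := hP
  obtain ⟨w2, h2⟩ := hQ
  refine ⟨max w1 w2, fun w hw => ?_⟩
  rw [ENNReal.ofReal_add h₁ h₂]
  refine le_trans (measure_mono ?_) ((measure_union_le _ _).trans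
    (add_le_add (h1 w (le_of_max_le_left hw)) (h2 w (le_of_max_le_right hw))))
  intro θ hθ
  by_cases hp : P w θ
  · exact Or.inr fun hq => hθ ⟨hp, hq⟩
  · exact Or.inl hp

lemma auxTail_mono {ε₁ ε₂ : ℝ} (h : ε₁ ≤ ε₂) {P Q : ∀ w : ℕ, DLNParams n0 nL w L → Prop}
    (w₁ : ℕ) (hPQ : ∀ w, w₁ ≤ w → ∀ θ, P w θ → Q w θ) (hP : auxTail L n0 nL γ ε₁ P) :
    auxTail L n0 nL γ ε₂ Q := by
  obtain ⟨w1, h1⟩ := hP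
  refine ⟨max w1 w₁, fun w hw => ?_⟩
  refine (measure_mono ?_).trans ((h1 w (le_of_max_le_left hw)).trans (ENNReal.ofReal_le_ofReal h))
  intro θ hθ hp
  exact hθ (hPQ w (le_of_max_le_right hw) θ hp)

lemma auxTail_forall {ι : Type*} (t : Finset ι) {P : ι → ∀ w : ℕ, DLNParams n0 nL w L → Prop}
    (h : ∀ i ∈ t, ∀ ε > 0, auxTail L n0 nL γ ε (P i)) (ε : ℝ) (hε : 0 < ε) :
    auxTail L n0 nL γ ε fun w θ => ∀ i ∈ t, P i w θ := by
  classical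
  induction t using Finset.induction_on generalizing ε with
  | empty => exact ⟨0, fun w _ => by simp⟩
  | insert a s ha ih =>
    have h1 := ih (fun i hi => h i (Finset.mem_insert_of_mem hi)) (ε / 2) (by positivity)
    have h2 := h a (Finset.mem_insert_self a s) (ε / 2) (by positivity)
    refine auxTail_mono (by linarith) 0 ?_ (auxTail_and (by positivity) (by positivity) h1 h2)
    rintro w - θ ⟨hp, hq⟩ i hi
    rcases Finset.mem_insert.1 hi with rfl | hi
    · exact hq
    · exact hp i hi

lemma aux_geo (c : ℕ) (ε : ℝ) (hε : 0 < ε) : ∃ w₀ : ℕ, ∀ w : ℕ, w₀ ≤ w →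
    (c : ENNReal) * ENNReal.ofReal ((3 / 4) ^ w) ≤ ENNReal.ofReal ε := by
  have h : Filter.Tendsto (fun w : ℕ => (c : ℝ) * (3 / 4 : ℝ) ^ w) Filter.atTop (nhds 0) := by
    simpa using (tendsto_pow_atTop_nhds_zero_of_lt_one (r := (3 / 4 : ℝ)) (by norm_num)
      (by norm_num)).const_mul (c : ℝ)
  obtain ⟨w0, h0⟩ := Filter.eventually_atTop.1 (h.eventually (gt_mem_nhds hε))
  refine ⟨w0, fun w hw => ?_⟩
  rw [← ENNReal.ofReal_natCast, ← ENNReal.ofReal_mul (Nat.cast_nonneg c)]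
  exact ENNReal.ofReal_le_ofReal (h0 w hw).le

lemma auxT_vec (x : Fin n0 → ℝ) (ε : ℝ) (hε : 0 < ε) :
    auxTail L n0 nL γ ε fun w θ =>
      ((auxS γ w / 2) ^ (L - 2 + 1)) ^ 2 * ∑ j, x j ^ 2 ≤ ∑ i, ((auxH θ (L - 2)).mulVec x i) ^ 2 := by
  obtain ⟨w0, h0⟩ := aux_geo (L - 2 + 1) ε hε
  refine ⟨max w0 1, fun w hw => ?_⟩
  have hw1 : 1 ≤ w := le_of_max_le_right hw
  refine le_trans (le_of_eq ?_) ((auxF_vec (n0 := n0) (nL := nL) (w := w) (L := L)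
    _ (auxV_ne γ w hw1) x (L - 2) le_rfl).trans (h0 w (le_of_max_le_left hw)))
  rw [dlnGauss]
  congr 1
  ext θ
  simp only [Set.mem_ofPred_eq, not_le]
  rw [← auxS_sq γ w hw1]
  have : ((auxS γ w / 2) ^ (L - 2 + 1)) ^ 2 = (auxS γ w ^ 2 / 4) ^ (L - 2 + 1) := by
    rw [← pow_mul, mul_comm, pow_mul]; congr 1; ring
  rw [this]

lemma auxT_bdd (ε : ℝ) (hε : 0 < ε) : ∃ K : ℝ, 1 ≤ K ∧
    auxTail L n0 nL γ ε fun w θ => auxBdd θ (K * auxS γ w) := by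
  obtain ⟨K, hK56, hKn⟩ : ∃ K : ℝ, 56 ≤ K ∧ ((n0 : ℝ) + nL) / (ε / 3) ≤ K := 
    ⟨max 56 (((n0 : ℝ) + nL) / (ε / 3)), le_max_left _ _, le_max_right _ _⟩
  rw [div_le_iff₀ (by positivity)] at hKn
  have hK0 : 0 < K := by linarith
  have hKK : K ≤ K ^ 2 := by nlinarith
  have hm : auxTail L n0 nL γ (ε / 3) fun w θ => ∀ k ∈ (Finset.univ : Finset (Fin (L - 2))),
      ¬ 56 * auxS γ w < auxOpN (dlnWmid θ k) := by
    apply auxTail_forall _ _ _ (by positivity)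
    intro k _ ε' hε'
    obtain ⟨w0, h0⟩ := aux_geo 1 ε' hε'
    refine ⟨max w0 1, fun w hw => ?_⟩
    have hw1 : 1 ≤ w := le_of_max_le_right hw
    simp only [not_not]
    have h0' := h0 w (le_of_max_le_left hw)
    rw [Nat.cast_one, one_mul] at h0'
    exact (auxF_mid hw1 _ _ (auxS_pos γ w hw1) (auxS_sq γ w hw1) k).trans h0'
  have h1 : auxTail L n0 nL γ (ε / 3) fun w θ =>
      ¬ (K * auxS γ w) ^ 2 < ∑ i, ∑ j, dlnW1 θ i j ^ 2 := by
    refine ⟨1, fun w hw => ?_⟩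
    have hs := auxS_pos γ w hw
    simp only [not_not]
    refine (auxF_W1 _ _ (by positivity)).trans (ENNReal.ofReal_le_ofReal ?_)
    rw [← auxS_sq γ w hw, div_le_iff₀ (by positivity)]
    have : (n0 : ℝ) ≤ ε / 3 * K ^ 2 := by
      have : ε / 3 * K ≤ ε / 3 * K ^ 2 := by gcongr
      have : (0 : ℝ) ≤ nL := Nat.cast_nonneg _
      linarith
    calc (n0 : ℝ) * auxS γ w ^ 2 ≤ (ε / 3 * K ^ 2) * auxS γ w ^ 2 := by gcongr
      _ = _ := by ring
  have h2 : auxTail L n0 nL γ (ε / 3) fun w θ =>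
      ¬ (K * auxS γ w) ^ 2 < ∑ i, ∑ j, dlnWL θ i j ^ 2 := by
    refine ⟨1, fun w hw => ?_⟩
    have hs := auxS_pos γ w hw
    simp only [not_not]
    refine (auxF_WL _ _ (by positivity)).trans (ENNReal.ofReal_le_ofReal ?_)
    rw [← auxS_sq γ w hw, div_le_iff₀ (by positivity)]
    have : (nL : ℝ) ≤ ε / 3 * K ^ 2 := by
      have : ε / 3 * K ≤ ε / 3 * K ^ 2 := by gcongr
      have : (0 : ℝ) ≤ n0 := Nat.cast_nonneg _
      linarith
    calc (nL : ℝ) * auxS γ w ^ 2 ≤ (ε / 3 * K ^ 2) * auxS γ w ^ 2 := by gcongr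
      _ = _ := by ring
  refine ⟨K, by linarith, ?_⟩
  have e3 : 0 ≤ ε / 3 := by positivity
  refine auxTail_mono (by linarith) 1 ?_
    (auxTail_and e3 (by linarith) hm (auxTail_and e3 e3 h1 h2))
  rintro w hw θ ⟨a1, a2, a3⟩
  refine ⟨fun k => ?_, not_lt.1 a2, not_lt.1 a3⟩
  refine (not_lt.1 (a1 k (Finset.mem_univ k))).trans ?_
  have := auxS_pos γ w hw
  gcongr

end

lemma aux_net (n : ℕ) (η : ℝ) (hη : 0 < η) : ∃ t : Finset (Fin n → ℝ),
    (∀ y ∈ t, ‖WithLp.toLp 2 y‖ = 1) ∧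
    ∀ x : Fin n → ℝ, ‖WithLp.toLp 2 x‖ = 1 → ∃ y ∈ t, ‖WithLp.toLp 2 (y - x)‖ ≤ η := by
  classical
  obtain ⟨t, ht, hf, hc⟩ := (isCompact_sphere (0 : EuclideanSpace ℝ (Fin n)) 1).finite_cover_balls hη
  refine ⟨hf.toFinset.image (fun y => y.ofLp), ?_, ?_⟩
  · intro y hy
    obtain ⟨z, hz, rfl⟩ := Finset.mem_image.1 hy
    have := ht (hf.mem_toFinset.1 hz)
    simpa using this
  · intro x hx
    have hx' : WithLp.toLp 2 x ∈ Metric.sphere (0 : EuclideanSpace ℝ (Fin n)) 1 := by simpa using hx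
    obtain ⟨y, hy, hxy⟩ := Set.mem_iUnion₂.1 (hc hx')
    refine ⟨y.ofLp, Finset.mem_image_of_mem _ (hf.mem_toFinset.2 hy), ?_⟩
    rw [Metric.mem_ball, dist_comm, dist_eq_norm] at hxy
    refine le_trans (le_of_eq ?_) hxy.le
    congr 1

section
open scoped Matrix.Norms.L2Operator

lemma aux_net_lower {w n : ℕ} (H : Matrix (Fin w) (Fin n) ℝ) (t : Finset (Fin n → ℝ))
    (η M b : ℝ) (hM : ‖H‖ ≤ M) (hb : 0 ≤ b) (hη : M * η ≤ b / 2)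
    (hη0 : 0 ≤ η)
    (ht1 : ∀ y ∈ t, ‖WithLp.toLp 2 y‖ = 1)
    (ht : ∀ x : Fin n → ℝ, ‖WithLp.toLp 2 x‖ = 1 → ∃ y ∈ t, ‖WithLp.toLp 2 (y - x)‖ ≤ η)
    (hy : ∀ y ∈ t, b ^ 2 * ∑ j, y j ^ 2 ≤ ∑ i, (H.mulVec y i) ^ 2) (x : Fin n → ℝ) :
    (b / 2) ^ 2 * ∑ j, x j ^ 2 ≤ ∑ i, (H.mulVec x i) ^ 2 := by
  have key : ∀ x : Fin n → ℝ, ‖WithLp.toLp 2 x‖ = 1 → b / 2 ≤ ‖WithLp.toLp 2 (H.mulVec x)‖ := by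
    intro x hx
    obtain ⟨y, hyt, hyx⟩ := ht x hx
    have h1 := hy y hyt
    rw [← aux_norm_sq, ← aux_norm_sq, ht1 y hyt, one_pow, mul_one] at h1
    have h2 : b ≤ ‖WithLp.toLp 2 (H.mulVec y)‖ := by
      exact (sq_le_sq₀ hb (norm_nonneg _)).1 h1
    have h3 : ‖WithLp.toLp 2 (H.mulVec (y - x))‖ ≤ M * η :=
      (aux_mulVec_norm H (y - x)).trans (mul_le_mul hM hyx (norm_nonneg _) ((norm_nonneg _).trans hM))
    have h4 : WithLp.toLp 2 (H.mulVec y) =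
        WithLp.toLp 2 (H.mulVec x) + WithLp.toLp 2 (H.mulVec (y - x)) := by
      rw [Matrix.mulVec_sub, ← WithLp.toLp_add]; congr 1; abel
    have h5 := norm_add_le (WithLp.toLp 2 (H.mulVec x)) (WithLp.toLp 2 (H.mulVec (y - x)))
    rw [← h4] at h5
    linarith
  rw [← aux_norm_sq, ← aux_norm_sq, ← mul_pow]
  refine pow_le_pow_left₀ (by positivity) ?_ 2
  by_cases h0 : ‖WithLp.toLp 2 x‖ = 0
  · rw [h0, mul_zero]; positivity
  · have hp : 0 < ‖WithLp.toLp 2 x‖ := lt_of_le_of_ne (norm_nonneg _) (Ne.symm h0)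
    have := key (‖WithLp.toLp 2 x‖⁻¹ • x) (by
      rw [WithLp.toLp_smul, norm_smul, norm_inv, norm_norm, inv_mul_cancel₀ h0])
    rw [Matrix.mulVec_smul, WithLp.toLp_smul, norm_smul, norm_inv, norm_norm,
      inv_mul_eq_div, le_div_iff₀ hp] at this
    exact this

variable {L n0 nL : ℕ} {γ : ℝ}

lemma auxH_bound {w : ℕ} (θ : DLNParams n0 nL w L) (B : ℝ) (hB : 0 ≤ B) (hb : auxBdd θ B) :
    ‖auxH θ (L - 2)‖ ≤ B ^ (L - 2 + 1) := by
  refine (auxH_pert θ θ B 0 hB le_rfl zero_le_one hb ?_).1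
  simp [dlnDist]

/-- lower singular value constant -/
def auxc (L : ℕ) : ℝ := (1 / 2) ^ (L - 2 + 1) / 2

lemma auxc_pos (L : ℕ) : 0 < auxc L := by unfold auxc; positivity

lemma auxT_lower (ε : ℝ) (hε : 0 < ε) : auxTail L n0 nL γ ε fun w θ => ∀ x : Fin n0 → ℝ,
    (auxc L * auxS γ w ^ (L - 2 + 1)) ^ 2 * ∑ j, x j ^ 2 ≤ ∑ i, ((auxH θ (L - 2)).mulVec x i) ^ 2 := by
  obtain ⟨K, hK, hb⟩ := auxT_bdd (L := L) (n0 := n0) (nL := nL) (γ := γ) (ε / 2) (by positivity)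
  have hc := auxc_pos L
  obtain ⟨t, ht1, ht⟩ := aux_net n0 (auxc L / K ^ (L - 2 + 1)) (by positivity)
  have hv := auxTail_forall (L := L) (n0 := n0) (nL := nL) (γ := γ) t
    (fun x _ ε' hε' => auxT_vec x ε' hε') (ε / 2) (by positivity)
  refine auxTail_mono (by linarith) 1 ?_ (auxTail_and (by positivity) (by positivity) hb hv)
  rintro w hw θ ⟨h1, h2⟩ x
  have hs := auxS_pos γ w hw
  have := aux_net_lower (auxH θ (L - 2)) t _ _ ((auxS γ w / 2) ^ (L - 2 + 1))
    (auxH_bound θ _ (by positivity) h1) (by positivity) ?_ (by positivity) ht1 ht h2 x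
  · have e : auxc L * auxS γ w ^ (L - 2 + 1) = (auxS γ w / 2) ^ (L - 2 + 1) / 2 := by
      rw [auxc, div_pow, div_pow, one_pow]; ring
    rw [e]; exact this
  · apply le_of_eq
    rw [auxc, mul_pow, div_pow, div_pow, one_pow]
    field_simp

lemma auxT_upper (ε : ℝ) (hε : 0 < ε) : ∃ R : ℝ, 0 < R ∧ auxTail L n0 nL γ ε fun w θ => ∀ i j,
    dlnMatrix θ i j ^ 2 ≤ R * ((w : ℝ) ^ (-γ) * (auxS γ w ^ (L - 2 + 1)) ^ 2) := by
  classical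
  obtain ⟨K, hK, hb⟩ := auxT_bdd (L := L) (n0 := n0) (nL := nL) (γ := γ) (ε / 2) (by positivity)
  obtain ⟨N, hN, hN0⟩ : ∃ N : ℝ, N = (nL : ℝ) * n0 + 1 ∧ 0 < N := ⟨_, rfl, by positivity⟩
  have hK0 : 0 < K := by linarith
  obtain ⟨R, hR⟩ : ∃ R : ℝ, R = (K ^ (L - 2 + 1)) ^ 2 / (ε / 2 / N) := ⟨_, rfl⟩
  have hR0 : 0 < R := by rw [hR]; positivity
  refine ⟨R, hR0, ?_⟩
  obtain ⟨w0, h0⟩ := hb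
  refine ⟨max w0 1, fun w hw => ?_⟩
  have hw1 : 1 ≤ w := le_of_max_le_right hw
  have hs := auxS_pos γ w hw1
  have hwp : (0 : ℝ) < w := by exact_mod_cast hw1
  have hv : 0 < (w : ℝ) ^ (-γ) := Real.rpow_pos_of_pos hwp _
  set T := R * ((w : ℝ) ^ (-γ) * (auxS γ w ^ (L - 2 + 1)) ^ 2) with hT
  set h := ((K * auxS γ w) ^ (L - 2 + 1)) ^ 2 with hh
  set F : Fin nL × Fin n0 → Fin nL → Fin n0 → ℝ := fun p i j => if (i, j) = p then 1 else 0 with hF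
  have hlin : ∀ (θ : DLNParams n0 nL w L) (p : Fin nL × Fin n0),
      ∑ i, ∑ j, F p i j * dlnMatrix θ i j = dlnMatrix θ p.1 p.2 := by
    intro θ p
    rw [← Fintype.sum_prod_type' (f := fun i j => F p i j * dlnMatrix θ i j)]
    simp [hF]
  have hcoef : ∀ (θ : DLNParams n0 nL w L) (p : Fin nL × Fin n0), auxBdd θ (K * auxS γ w) →
      ∑ q : Fin nL × Fin w, ((auxH θ (L - 2)).mulVec (F p q.1) q.2) ^ 2 ≤ h := by
    intro θ p hbd
    have e : ∀ i, ∑ k, ((auxH θ (L - 2)).mulVec (F p i) k) ^ 2 ≤ h * ∑ j, F p i j ^ 2 := by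
      intro i
      rw [← aux_norm_sq, ← aux_norm_sq, hh, ← mul_pow]
      refine pow_le_pow_left₀ (norm_nonneg _) ((aux_mulVec_norm _ _).trans ?_) 2
      have := auxH_bound θ _ (by positivity) hbd
      gcongr
    rw [Fintype.sum_prod_type]
    refine (Finset.sum_le_sum fun i _ => e i).trans (le_of_eq ?_)
    rw [← Finset.mul_sum, ← Fintype.sum_prod_type' (f := fun i j => F p i j ^ 2)]
    simp [hF]
  have hT0 : 0 < T := by positivity
  have hub := fun p : Fin nL × Fin n0 => auxF_upper (n0 := n0) (nL := nL) (w := w) (L := L)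
    (Real.toNNReal ((w : ℝ) ^ (-γ))) (F p) h T hT0
  have hval : h * (Real.toNNReal ((w : ℝ) ^ (-γ)) : NNReal) / T = ε / 2 / N := by
    rw [auxV_coe, hh, hT, hR, mul_pow]; field_simp
  rw [hval] at hub
  refine le_trans (measure_mono (t := {θ | ¬ auxBdd θ (K * auxS γ w)} ∪ ⋃ p : Fin nL × Fin n0,
    {θ : DLNParams n0 nL w L |
        ∑ q : Fin nL × Fin w, ((auxH θ (L - 2)).mulVec (F p q.1) q.2) ^ 2 ≤ h ∧
        T < (∑ i, ∑ j, F p i j * dlnMatrix θ i j) ^ 2}) ?_)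
    ((measure_union_le _ _).trans ((add_le_add (h0 w (le_of_max_le_left hw))
      ((measure_iUnion_fintype_le _ _).trans (Finset.sum_le_sum fun p _ => hub p))).trans ?_))
  · intro θ hθ
    by_cases hbd : auxBdd θ (K * auxS γ w)
    · right
      simp only [Set.mem_ofPred_eq, not_forall, not_le] at hθ
      obtain ⟨i, j, hij⟩ := hθ
      refine Set.mem_iUnion.2 ⟨(i, j), hcoef θ (i, j) hbd, ?_⟩
      simp only [hlin]
      exact hij
    · left; exact hbd
  · rw [Finset.sum_const, nsmul_eq_mul, ← ENNReal.ofReal_natCast, ← ENNReal.ofReal_mul (by positivity),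
      ← ENNReal.ofReal_add (by positivity) (by positivity)]
    apply ENNReal.ofReal_le_ofReal
    have : ((Finset.univ : Finset (Fin nL × Fin n0)).card : ℝ) ≤ N := by
      rw [hN]; simp
    have h2 : ((Finset.univ : Finset (Fin nL × Fin n0)).card : ℝ) * (ε / 2 / N) ≤ N * (ε / 2 / N) := by
      gcongr
    rw [mul_div_cancel₀ _ hN0.ne'] at h2
    linarith

end

lemma aux_hyper {E : Type*} [NormedAddCommGroup E] [NormedSpace ℝ E] [FiniteDimensional ℝ E]
    (S : Set E) (hS : Convex ℝ S) (hne : S.Nonempty) (hIntEq : interior S = ∅) :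
    ∃ f : E →ₗ[ℝ] ℝ, f ≠ 0 ∧ ∃ b : ℝ, ∀ A ∈ S, f A = b := by
  have h1 : affineSpan ℝ S ≠ ⊤ := by
    intro h
    have := hS.interior_nonempty_iff_affineSpan_eq_top.2 h
    rw [hIntEq] at this
    exact Set.not_nonempty_empty this
  have h2 : (affineSpan ℝ S).direction ≠ ⊤ := by
    intro h
    exact h1 ((AffineSubspace.direction_eq_top_iff_of_nonempty (hne.affineSpan ℝ)).1 h)
  obtain ⟨f, hf, hle⟩ := Submodule.exists_le_ker_of_lt_top _ (lt_top_iff_ne_top.2 h2)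
  obtain ⟨p, hp⟩ := hne
  refine ⟨f, hf, f p, fun A hA => ?_⟩
  have h3 : A -ᵥ p ∈ (affineSpan ℝ S).direction :=
    AffineSubspace.vsub_mem_direction (subset_affineSpan ℝ S hA) (subset_affineSpan ℝ S hp)
  have h4 := hle h3
  rw [LinearMap.mem_ker, vsub_eq_sub, map_sub, sub_eq_zero] at h4
  exact h4

lemma aux_min_convex {E : Type*} [NormedAddCommGroup E] [NormedSpace ℝ E] (C : E → ℝ)
    (hconv : ConvexOn ℝ Set.univ C) : Convex ℝ {A : E | ∀ B, C A ≤ C B} := by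
  intro A hA A' hA' a b ha hb hab B
  have h := hconv.2 (Set.mem_univ A) (Set.mem_univ A') ha hb hab
  have h1 : C A ≤ C B := hA B
  have h2 : C A' ≤ C B := hA' B
  refine h.trans ?_
  simp only [smul_eq_mul]
  calc a * C A + b * C A' ≤ a * C B + b * C B := by gcongr
    _ = C B := by rw [← add_mul, hab, one_mul]

lemma aux_min_closed {E : Type*} [NormedAddCommGroup E] [NormedSpace ℝ E] (C : E → ℝ)
    (hdiff : Differentiable ℝ C) : IsClosed {A : E | ∀ B, C A ≤ C B} := by
  have : {A : E | ∀ B, C A ≤ C B} = ⋂ B, {A | C A ≤ C B} := by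
    ext A
    simp only [Set.mem_ofPred_eq, Set.mem_iInter]
  rw [this]
  exact isClosed_iInter fun B => isClosed_le hdiff.continuous continuous_const

lemma aux_lin_coord {n0 nL : ℕ} (f : (Fin nL → Fin n0 → ℝ) →ₗ[ℝ] ℝ) (D : Fin nL → Fin n0 → ℝ) :
    f D = ∑ i, ∑ j, f (Pi.single i (Pi.single j 1)) * D i j := by
  have : D = ∑ i, ∑ j, D i j • (Pi.single i (Pi.single j 1) : Fin nL → Fin n0 → ℝ) := by
    funext a b
    simp [Finset.sum_apply, Pi.single_apply, ite_apply]
  conv_lhs => rw [this]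
  simp only [map_sum, map_smul, smul_eq_mul]
  refine Finset.sum_congr rfl fun i _ => Finset.sum_congr rfl fun j _ => mul_comm _ _

lemma aux_lin_bound {n0 nL : ℕ} (F D : Fin nL → Fin n0 → ℝ) :
    |∑ i, ∑ j, F i j * D i j| ≤ (∑ i, ∑ j, |F i j|) * ‖D‖ := by
  rw [Finset.sum_mul]
  refine (Finset.abs_sum_le_sum_abs _ _).trans (Finset.sum_le_sum fun i _ => ?_)
  rw [Finset.sum_mul]
  refine (Finset.abs_sum_le_sum_abs _ _).trans (Finset.sum_le_sum fun j _ => ?_)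
  rw [abs_mul]
  have : |D i j| ≤ ‖D‖ := (norm_le_pi_norm (D i) j).trans (norm_le_pi_norm D i)
  gcongr

lemma auxT_gap {L n0 nL : ℕ} {γ : ℝ} (hL : 2 ≤ L) (hγ1 : 1 - 1 / (L : ℝ) ≤ γ)
    (C : (Fin nL → Fin n0 → ℝ) → ℝ)
    (hconv : ConvexOn ℝ Set.univ C) (hdiff : Differentiable ℝ C)
    (hne : {A : Fin nL → Fin n0 → ℝ | ∀ B, C A ≤ C B}.Nonempty)
    (hnull : volume {A : Fin nL → Fin n0 → ℝ | ∀ B, C A ≤ C B} = 0)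
    (h0 : ¬ (∀ B, C (0 : Fin nL → Fin n0 → ℝ) ≤ C B)) (ε : ℝ) (hε : 0 < ε) :
    ∃ δ : ℝ, 0 < δ ∧ auxTail L n0 nL γ ε fun _ θ => ∀ A, (∀ B, C A ≤ C B) →
      δ ≤ ‖dlnMatrix θ - A‖ := by
  rcases lt_or_eq_of_le (aux_exp_nonpos γ L hL hγ1) with he | he
  · have hopen : IsOpen {A : Fin nL → Fin n0 → ℝ | ∀ B, C A ≤ C B}ᶜ :=
      (aux_min_closed C hdiff).isOpen_compl
    obtain ⟨r, hr, hball⟩ := Metric.isOpen_iff.1 hopen 0 h0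
    obtain ⟨R, hR, hT⟩ := auxT_upper (L := L) (n0 := n0) (nL := nL) (γ := γ) ε hε
    refine ⟨r / 2, by positivity, ?_⟩
    have hlim : Filter.Tendsto (fun w : ℕ => R * (w : ℝ) ^ ((1 - γ) * L - 1)) Filter.atTop
        (nhds 0) := by
      have h1 := (tendsto_rpow_neg_atTop (y := -((1 - γ) * L - 1)) (by linarith)).comp
        tendsto_natCast_atTop_atTop
      rw [neg_neg] at h1
      simpa using h1.const_mul R
    obtain ⟨w1, hw1⟩ := Filter.eventually_atTop.1
      (hlim.eventually (gt_mem_nhds (show 0 < (r / 2) ^ 2 by positivity)))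
    refine auxTail_mono le_rfl (max w1 1) ?_ hT
    intro w hw θ hθ A hA
    have hw' : 1 ≤ w := le_of_max_le_right hw
    have hb := hw1 w (le_of_max_le_left hw)
    have hn : ‖dlnMatrix θ‖ ≤ r / 2 := by
      rw [pi_norm_le_iff_of_nonneg (by positivity)]; intro i
      rw [pi_norm_le_iff_of_nonneg (by positivity)]; intro j
      have := hθ i j
      rw [auxS_total γ L hL w hw'] at this
      rw [Real.norm_eq_abs]
      exact abs_le_of_sq_le_sq (this.trans hb.le) (by positivity)
    have hA' : r ≤ ‖A‖ := by
      by_contra hlt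
      exact hball (by simpa using not_le.1 hlt) hA
    have := norm_sub_norm_le A (dlnMatrix θ)
    rw [norm_sub_rev] at this
    linarith
  · have hIntEq : interior {A : Fin nL → Fin n0 → ℝ | ∀ B, C A ≤ C B} = ∅ :=
      isOpen_interior.measure_eq_zero_iff (μ := volume) |>.1
        (measure_mono_null interior_subset hnull)
    obtain ⟨f, hf, b, hfb⟩ := aux_hyper _ (aux_min_convex C hconv) hne hIntEq
    set F : Fin nL → Fin n0 → ℝ := fun i j => f (Pi.single i (Pi.single j 1)) with hF
    have hfF : ∀ D, f D = ∑ i, ∑ j, F i j * D i j := aux_lin_coord f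
    obtain ⟨i0, j0, hij⟩ : ∃ i j, F i j ≠ 0 := by
      by_contra! h
      apply hf
      refine LinearMap.ext fun D => ?_
      rw [hfF]; simp [h]
    set q := ∑ j, F i0 j ^ 2 with hq
    have hq0 : 0 < q := by
      refine Finset.sum_pos' (fun j _ => sq_nonneg _) ⟨j0, Finset.mem_univ _, ?_⟩
      positivity
    set c := (1 / 2 : ℝ) ^ (L - 2 + 1) * Real.sqrt q with hc
    have hc0 : 0 < c := by positivity
    set Mf := (∑ i, ∑ j, |F i j|) + 1 with hMf
    have hMf0 : 0 < Mf := by positivity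
    refine ⟨ε * c / 4 / Mf, by positivity, ?_⟩
    have h1 := auxT_vec (L := L) (n0 := n0) (nL := nL) (γ := γ) (F i0) (ε / 2) (by positivity)
    have h2 : auxTail L n0 nL γ (ε / 2) fun w θ =>
        ¬ (c ^ 2 ≤ (∑ p : Fin nL × Fin w, ((auxH θ (L - 2)).mulVec (F p.1) p.2) ^ 2) *
          (Real.toNNReal ((w : ℝ) ^ (-γ)) : NNReal) ∧
        |(∑ i, ∑ j, F i j * dlnMatrix θ i j) - b| ≤ ε * c / 4) := by
      refine ⟨0, fun w _ => ?_⟩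
      simp only [not_not]
      refine (auxF_lower _ F b (ε * c / 4) c hc0).trans (ENNReal.ofReal_le_ofReal (le_of_eq ?_))
      field_simp; norm_num
    refine auxTail_mono (by linarith) 1 ?_ (auxTail_and (by positivity) (by positivity) h1 h2)
    rintro w hw θ ⟨e1, e2⟩ A hA
    by_contra hlt
    apply e2
    constructor
    · have hs := auxS_total γ L hL w hw
      rw [he, Real.rpow_zero] at hs
      rw [auxV_coe, hc, mul_pow, Real.sq_sqrt hq0.le]
      have hv : 0 ≤ (w : ℝ) ^ (-γ) := Real.rpow_nonneg (Nat.cast_nonneg w) _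
      have e3 : ∑ i, ((auxH θ (L - 2)).mulVec (F i0) i) ^ 2 ≤
          ∑ p : Fin nL × Fin w, ((auxH θ (L - 2)).mulVec (F p.1) p.2) ^ 2 := by
        rw [Fintype.sum_prod_type]
        exact Finset.single_le_sum (f := fun i => ∑ k, ((auxH θ (L - 2)).mulVec (F i) k) ^ 2)
          (fun i _ => Finset.sum_nonneg fun k _ => sq_nonneg _) (Finset.mem_univ i0)
      calc ((1 / 2 : ℝ) ^ (L - 2 + 1)) ^ 2 * q
          = ((auxS γ w / 2) ^ (L - 2 + 1)) ^ 2 * q * (w : ℝ) ^ (-γ) := by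
            rw [div_pow, div_pow, div_pow, div_pow, one_pow, one_pow]
            calc _ = 1 / (2 ^ (L - 2 + 1)) ^ 2 * q := by ring
              _ = ((w : ℝ) ^ (-γ) * (auxS γ w ^ (L - 2 + 1)) ^ 2) / (2 ^ (L - 2 + 1)) ^ 2 * q := by
                rw [hs]
              _ = _ := by ring
        _ ≤ _ := by gcongr; exact e1.trans e3
    · have hfa : b = ∑ i, ∑ j, F i j * A i j := by rw [← hfF, hfb A hA]
      have hd : (∑ i, ∑ j, F i j * dlnMatrix θ i j) - b
          = ∑ i, ∑ j, F i j * (dlnMatrix θ - A) i j := by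
        rw [hfa, ← Finset.sum_sub_distrib]
        refine Finset.sum_congr rfl fun i _ => ?_
        rw [← Finset.sum_sub_distrib]
        refine Finset.sum_congr rfl fun j _ => ?_
        simp only [Pi.sub_apply]; ring
      rw [hd]
      refine (aux_lin_bound F _).trans ?_
      have h5 := (not_le.1 hlt).le
      rw [le_div_iff₀ hMf0] at h5
      refine le_trans ?_ h5
      rw [mul_comm]
      have := norm_nonneg (dlnMatrix θ - A)
      gcongr
      rw [hMf]; linarith

section
open scoped Matrix.Norms.L2Operator

lemma aux_lower_pert {w n : ℕ} (H H' : Matrix (Fin w) (Fin n) ℝ) (a : ℝ) (ha : 0 < a)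
    (hH : ∀ x : Fin n → ℝ, a ^ 2 * ∑ j, x j ^ 2 ≤ ∑ i, (H.mulVec x i) ^ 2)
    (hd : ‖H' - H‖ ≤ a / 2) (x : Fin n → ℝ) :
    (a / 2) ^ 2 * ∑ j, x j ^ 2 ≤ ∑ i, (H'.mulVec x i) ^ 2 := by
  have h1 := hH x
  rw [← aux_norm_sq, ← aux_norm_sq, ← mul_pow] at h1 ⊢
  have h2 := (sq_le_sq₀ (by positivity) (norm_nonneg _)).1 h1
  refine pow_le_pow_left₀ (by positivity) ?_ 2
  have h3 : ‖WithLp.toLp 2 ((H' - H).mulVec x)‖ ≤ a / 2 * ‖WithLp.toLp 2 x‖ :=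
    (aux_mulVec_norm _ x).trans (by gcongr)
  have h4 : WithLp.toLp 2 (H.mulVec x) =
      WithLp.toLp 2 (H'.mulVec x) - WithLp.toLp 2 ((H' - H).mulVec x) := by
    rw [Matrix.sub_mulVec, ← WithLp.toLp_sub]; congr 1; abel
  have h5 := norm_sub_le (WithLp.toLp 2 (H'.mulVec x)) (WithLp.toLp 2 ((H' - H).mulVec x))
  rw [← h4] at h5
  linarith

variable {L n0 nL w : ℕ}

lemma aux_dm_nonneg (C : (Fin nL → Fin n0 → ℝ) → ℝ) (θ : DLNParams n0 nL w L) : 0 ≤ dlnDm C θ := by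
  refine Real.sInf_nonneg ?_
  rintro _ ⟨θ', -, rfl⟩; exact aux_dist_nonneg _ _

lemma aux_ds_nonneg (C : (Fin nL → Fin n0 → ℝ) → ℝ) (θ : DLNParams n0 nL w L) : 0 ≤ dlnDs C θ := by
  refine Real.sInf_nonneg ?_
  rintro _ ⟨θ', -, rfl⟩; exact aux_dist_nonneg _ _

lemma aux_dm_le (C : (Fin nL → Fin n0 → ℝ) → ℝ) (θ θ' : DLNParams n0 nL w L)
    (h : DLNIsGlobalMin C θ') : dlnDm C θ ≤ dlnDist θ θ' := by
  refine csInf_le ⟨0, ?_⟩ ⟨θ', h, rfl⟩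
  rintro _ ⟨θ', -, rfl⟩; exact aux_dist_nonneg _ _

lemma aux_ds_le (C : (Fin nL → Fin n0 → ℝ) → ℝ) (θ θ' : DLNParams n0 nL w L)
    (h : DLNIsSaddle C θ') : dlnDs C θ ≤ dlnDist θ θ' := by
  refine csInf_le ⟨0, ?_⟩ ⟨θ', h, rfl⟩
  rintro _ ⟨θ', -, rfl⟩; exact aux_dist_nonneg _ _

lemma aux_le_dm (C : (Fin nL → Fin n0 → ℝ) → ℝ) (θ : DLNParams n0 nL w L)
    (hne : ∃ θ' : DLNParams n0 nL w L, DLNIsGlobalMin C θ') (r M : ℝ) (hM : 0 < M)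
    (h : ∀ θ' : DLNParams n0 nL w L, DLNIsGlobalMin C θ' → r ≤ M * dlnDist θ θ') :
    r ≤ M * dlnDm C θ := by
  rw [← div_le_iff₀' hM]
  obtain ⟨θ', h'⟩ := hne
  refine le_csInf ⟨_, θ', h', rfl⟩ ?_
  rintro _ ⟨θ', h', rfl⟩
  rw [div_le_iff₀' hM]; exact h θ' h'

lemma aux_le_ds (C : (Fin nL → Fin n0 → ℝ) → ℝ) (θ : DLNParams n0 nL w L)
    (hne : ∃ θ' : DLNParams n0 nL w L, DLNIsSaddle C θ') (r M : ℝ) (hM : 0 < M)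
    (h : ∀ θ' : DLNParams n0 nL w L, DLNIsSaddle C θ' → r ≤ M * dlnDist θ θ') :
    r ≤ M * dlnDs C θ := by
  rw [← div_le_iff₀' hM]
  obtain ⟨θ', h'⟩ := hne
  refine le_csInf ⟨_, θ', h', rfl⟩ ?_
  rintro _ ⟨θ', h', rfl⟩
  rw [div_le_iff₀' hM]; exact h θ' h'

lemma aux_det_dm_up (C : (Fin nL → Fin n0 → ℝ) → ℝ) (θ : DLNParams n0 nL w L)
    (c S R : ℝ) (hc : 0 < c) (hS : 0 < S)
    (hH : ∀ x : Fin n0 → ℝ, (c * S) ^ 2 * ∑ j, x j ^ 2 ≤ ∑ i, ((auxH θ (L - 2)).mulVec x i) ^ 2)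
    (A : Fin nL → Fin n0 → ℝ) (hA : ∀ B, C A ≤ C B) (hR : ∀ i j, dlnMatrix θ i j ^ 2 ≤ R) :
    ∃ θ', DLNIsGlobalMin C θ' ∧
      dlnDist θ θ' ≤ (Real.sqrt (∑ i, ∑ j, (2 * A i j ^ 2 + 2 * R)) / c) * S⁻¹ := by
  have hsum : ∑ i, ∑ j, (A i j - dlnMatrix θ i j) ^ 2 ≤ ∑ i, ∑ j, (2 * A i j ^ 2 + 2 * R) := by
    refine Finset.sum_le_sum fun i _ => Finset.sum_le_sum fun j _ => ?_
    nlinarith [hR i j, sq_nonneg (A i j + dlnMatrix θ i j)]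
  have h0 : 0 ≤ ∑ i, ∑ j, (2 * A i j ^ 2 + 2 * R) :=
    (Finset.sum_nonneg fun i _ => Finset.sum_nonneg fun j _ => sq_nonneg _).trans hsum
  obtain ⟨θ', h1, h2⟩ := aux_dm_upper C θ (c * S) (by positivity) hH A hA
    (Real.sqrt (∑ i, ∑ j, (2 * A i j ^ 2 + 2 * R))) (Real.sqrt_nonneg _)
    (by rw [Real.sq_sqrt h0]; exact hsum)
  refine ⟨θ', h1, h2.trans (le_of_eq ?_)⟩
  rw [← div_div, div_eq_mul_inv _ S]

lemma aux_det_dm_low (C : (Fin nL → Fin n0 → ℝ) → ℝ) (θ θ' : DLNParams n0 nL w L)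
    (K s δ : ℝ) (hK : 1 ≤ K) (hs : 1 ≤ s) (hδ : 0 < δ) (hb : auxBdd θ (K * s))
    (hgap : ∀ A, (∀ B, C A ≤ C B) → δ ≤ ‖dlnMatrix θ - A‖) (hm : DLNIsGlobalMin C θ') :
    (s ^ (L - 2 + 1))⁻¹ ≤
      (1 + ((L - 2 + 1 + 1 : ℕ) : ℝ) * 2 ^ (L - 2 + 1 + 1) * K ^ (L - 2 + 1) / δ) * dlnDist θ θ' := by
  have hd0 := aux_dist_nonneg θ θ'
  have hK0 : 0 < K := by linarith
  have hs0 : 0 < s := by linarith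
  have hQ : 0 ≤ ((L - 2 + 1 + 1 : ℕ) : ℝ) * 2 ^ (L - 2 + 1 + 1) * K ^ (L - 2 + 1) / δ := by positivity
  rw [add_mul, one_mul]
  by_cases hB : K * s ≤ dlnDist θ θ'
  · have h1 : (s ^ (L - 2 + 1))⁻¹ ≤ 1 := inv_le_one_of_one_le₀ (one_le_pow₀ hs)
    have h2 : 1 ≤ K * s := by nlinarith
    have := mul_nonneg hQ hd0
    linarith
  · push Not at hB
    have hKs : 0 < K * s := by positivity
    have h := auxA_pert θ θ' (K * s) (dlnDist θ θ' / (K * s)) hKs.le (by positivity)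
      (by rw [div_le_one hKs]; exact hB.le) hb (by rw [div_mul_cancel₀ _ hKs.ne'])
    have h2 := (hgap _ hm).trans h
    have e : ((L - 2 + 1 + 1 : ℕ) : ℝ) * (dlnDist θ θ' / (K * s)) * (2 * (K * s)) ^ (L - 2 + 1 + 1)
        = ((L - 2 + 1 + 1 : ℕ) : ℝ) * 2 ^ (L - 2 + 1 + 1) * K ^ (L - 2 + 1) * dlnDist θ θ' *
          s ^ (L - 2 + 1) := by
      rw [mul_pow, pow_succ (K * s), mul_pow K s]
      field_simp
    rw [e] at h2
    have h3 : (s ^ (L - 2 + 1))⁻¹ ≤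
        ((L - 2 + 1 + 1 : ℕ) : ℝ) * 2 ^ (L - 2 + 1 + 1) * K ^ (L - 2 + 1) / δ * dlnDist θ θ' := by
      rw [inv_le_iff_one_le_mul₀ (by positivity), div_mul_eq_mul_div, div_mul_eq_mul_div,
        le_div_iff₀ hδ, one_mul]
      exact h2
    linarith

lemma aux_det_ds_low (C : (Fin nL → Fin n0 → ℝ) → ℝ)
    (hconv : ConvexOn ℝ Set.univ C) (hdiff : Differentiable ℝ C) (θ θ' : DLNParams n0 nL w L)
    (K s c ρ : ℝ) (hK : 1 ≤ K) (hs : 1 ≤ s) (hc : 0 < c) (hρ : 0 < ρ) (hρ1 : ρ ≤ 1)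
    (hρc : ((L - 2 + 1 : ℕ) : ℝ) * ρ * (2 * K) ^ (L - 2 + 1) ≤ c / 2) (hb : auxBdd θ (K * s))
    (hH : ∀ x : Fin n0 → ℝ, (c * s ^ (L - 2 + 1)) ^ 2 * ∑ j, x j ^ 2 ≤
      ∑ i, ((auxH θ (L - 2)).mulVec x i) ^ 2)
    (hm : DLNIsSaddle C θ') : s ≤ (ρ * K)⁻¹ * dlnDist θ θ' := by
  have hK0 : 0 < K := by linarith
  have hs0 : 0 < s := by linarith
  by_contra hlt
  push Not at hlt
  rw [inv_mul_eq_div, div_lt_iff₀ (by positivity)] at hlt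
  have h := (auxH_pert θ θ' (K * s) ρ (by positivity) hρ.le hρ1 hb (by linarith)).2
  have h2 : ‖auxH θ' (L - 2) - auxH θ (L - 2)‖ ≤ c * s ^ (L - 2 + 1) / 2 := by
    refine h.trans ?_
    calc ((L - 2 + 1 : ℕ) : ℝ) * ρ * (2 * (K * s)) ^ (L - 2 + 1)
        = ((L - 2 + 1 : ℕ) : ℝ) * ρ * (2 * K) ^ (L - 2 + 1) * s ^ (L - 2 + 1) := by
          rw [← mul_assoc 2 K s, mul_pow (2 * K) s]; ring
      _ ≤ c / 2 * s ^ (L - 2 + 1) := by gcongr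
      _ = _ := by ring
  exact aux_not_saddle C hconv hdiff θ' _ (by positivity)
    (aux_lower_pert _ _ _ (by positivity) hH h2) hm

end

lemma auxTail_lt {L n0 nL : ℕ} {γ ε : ℝ} (hε : 0 < ε)
    {P : ∀ w : ℕ, DLNParams n0 nL w L → Prop} (h : auxTail L n0 nL γ (ε / 2) P) :
    ∃ w₀ : ℕ, ∀ w : ℕ, w₀ ≤ w → 1 ≤ w ∧ ∀ S : Set (DLNParams n0 nL w L),
      (∀ θ ∈ S, ¬ P w θ) → dlnGauss n0 nL w L ((w : ℝ) ^ (-γ)) S < ENNReal.ofReal ε := by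
  obtain ⟨w0, h0⟩ := h
  refine ⟨max w0 1, fun w hw => ⟨le_of_max_le_right hw, fun S hS => ?_⟩⟩
  refine lt_of_le_of_lt ((measure_mono (fun θ hθ => hS θ hθ)).trans (h0 w (le_of_max_le_left hw))) ?_
  exact (ENNReal.ofReal_lt_ofReal_iff hε).2 (by linarith)

/-- **Distances to critical points at initialization, NTK regime (`1 - 1/L ≤ γ < 1`).**
With i.i.d. `N(0, w^{-γ})` initialization, `d_m ≍ w^{-(1-γ)(L-1)/2}` and
`d_s ≍ w^{(1-γ)/2}` as `w → ∞` (stochastic boundedness of both ratios). -/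
theorem dln_distances_ntk_regime
    (L n0 nL : ℕ) (hL : 2 ≤ L) (γ : ℝ)
    (hγ1 : 1 - 1 / (L : ℝ) ≤ γ) (hγ2 : γ < 1)
    (C : (Fin nL → Fin n0 → ℝ) → ℝ)
    (hconv : ConvexOn ℝ Set.univ C) (hdiff : Differentiable ℝ C)
    (hne : {A : Fin nL → Fin n0 → ℝ | ∀ B, C A ≤ C B}.Nonempty)
    (hnull : volume {A : Fin nL → Fin n0 → ℝ | ∀ B, C A ≤ C B} = 0)
    (h0 : ¬ (∀ B, C (0 : Fin nL → Fin n0 → ℝ) ≤ C B)) :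
    (∀ ε : ℝ, 0 < ε → ∃ (M : ℝ) (w₀ : ℕ), ∀ w : ℕ, w₀ ≤ w →
        dlnGauss n0 nL w L ((w : ℝ) ^ (-γ))
            {θ | dlnDm C θ > M * (w : ℝ) ^ (-((1 - γ) * ((L : ℝ) - 1)) / 2)}
          < ENNReal.ofReal ε ∧
        dlnGauss n0 nL w L ((w : ℝ) ^ (-γ))
            {θ | (w : ℝ) ^ (-((1 - γ) * ((L : ℝ) - 1)) / 2) > M * dlnDm C θ}
          < ENNReal.ofReal ε) ∧
    (∀ ε : ℝ, 0 < ε → ∃ (M : ℝ) (w₀ : ℕ), ∀ w : ℕ, w₀ ≤ w →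
        dlnGauss n0 nL w L ((w : ℝ) ^ (-γ))
            {θ | dlnDs C θ > M * (w : ℝ) ^ ((1 - γ) / 2)} < ENNReal.ofReal ε ∧
        dlnGauss n0 nL w L ((w : ℝ) ^ (-γ))
            {θ | (w : ℝ) ^ ((1 - γ) / 2) > M * dlnDs C θ} < ENNReal.ofReal ε) := by
  obtain ⟨A, hA⟩ := hne
  have hA' : ∀ B, C A ≤ C B := hA
  have hn0 : 0 < n0 := by
    rcases Nat.eq_zero_or_pos n0 with h | h
    · subst h
      exact absurd (by rw [Subsingleton.elim (0 : Fin nL → Fin 0 → ℝ) A]; exact hA') h0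
    · exact h
  have hc := auxc_pos L
  constructor
  · intro ε hε
    obtain ⟨K, hK, t1⟩ := auxT_bdd (L := L) (n0 := n0) (nL := nL) (γ := γ) (ε / 8) (by positivity)
    have t2 := auxT_lower (L := L) (n0 := n0) (nL := nL) (γ := γ) (ε / 8) (by positivity)
    obtain ⟨R, hR, t3⟩ := auxT_upper (L := L) (n0 := n0) (nL := nL) (γ := γ) (ε / 8) (by positivity)
    obtain ⟨δ, hδ, t4⟩ := auxT_gap hL hγ1 C hconv hdiff ⟨A, hA⟩ hnull h0 (ε / 8) (by positivity)
    have e8 : 0 ≤ ε / 8 := by positivity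
    have t := auxTail_and (by linarith) (by linarith) (auxTail_and e8 e8 t1 t2)
      (auxTail_and e8 e8 t3 t4)
    rw [show ε / 8 + ε / 8 + (ε / 8 + ε / 8) = ε / 2 by ring] at t
    obtain ⟨w0, hw0⟩ := auxTail_lt hε t
    set M1 := Real.sqrt (∑ i, ∑ j, (2 * A i j ^ 2 + 2 * R)) / auxc L with hM1
    set M2 := 1 + ((L - 2 + 1 + 1 : ℕ) : ℝ) * 2 ^ (L - 2 + 1 + 1) * K ^ (L - 2 + 1) / δ with hM2
    have hM2p : 0 < M2 := by positivity
    refine ⟨max M1 M2, w0, fun w hw => ?_⟩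
    obtain ⟨hw1, hS⟩ := hw0 w hw
    have hs1 := auxS_one γ hγ2 w hw1
    have hs0 := auxS_pos γ w hw1
    have hwr : (1 : ℝ) ≤ w := by exact_mod_cast hw1
    rw [auxS_inv γ L hL w hw1]
    have htot : R * ((w : ℝ) ^ (-γ) * (auxS γ w ^ (L - 2 + 1)) ^ 2) ≤ R := by
      rw [auxS_total γ L hL w hw1]
      have := Real.rpow_le_one_of_one_le_of_nonpos hwr (aux_exp_nonpos γ L hL hγ1)
      nlinarith
    constructor
    · apply hS
      rintro θ hθ ⟨⟨a1, a2⟩, a3, a4⟩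
      obtain ⟨θ', b1, b2⟩ := aux_det_dm_up C θ (auxc L) (auxS γ w ^ (L - 2 + 1)) R hc
        (by positivity) a2 A hA' (fun i j => (a3 i j).trans htot)
      have b3 := (aux_dm_le C θ θ' b1).trans b2
      have b4 : M1 * (auxS γ w ^ (L - 2 + 1))⁻¹ ≤ max M1 M2 * (auxS γ w ^ (L - 2 + 1))⁻¹ := by
        gcongr; exact le_max_left _ _
      exact absurd hθ (not_lt.2 (b3.trans b4))
    · apply hS
      rintro θ hθ ⟨⟨a1, a2⟩, a3, a4⟩
      obtain ⟨θ', b1, -⟩ := aux_det_dm_up C θ (auxc L) (auxS γ w ^ (L - 2 + 1)) R hc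
        (by positivity) a2 A hA' (fun i j => (a3 i j).trans htot)
      have b3 := aux_le_dm C θ ⟨θ', b1⟩ _ M2 hM2p
        (fun θ'' h'' => aux_det_dm_low C θ θ'' K (auxS γ w) δ hK hs1 hδ a1 a4 h'')
      have b4 : M2 * dlnDm C θ ≤ max M1 M2 * dlnDm C θ :=
        mul_le_mul_of_nonneg_right (le_max_right _ _) (aux_dm_nonneg C θ)
      exact absurd hθ (not_lt.2 (b3.trans b4))
  · intro ε hε
    obtain ⟨K, hK, t1⟩ := auxT_bdd (L := L) (n0 := n0) (nL := nL) (γ := γ) (ε / 4) (by positivity)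
    have t2 := auxT_lower (L := L) (n0 := n0) (nL := nL) (γ := γ) (ε / 4) (by positivity)
    have e8 : 0 ≤ ε / 4 := by positivity
    have t := auxTail_and e8 e8 t1 t2
    rw [show ε / 4 + ε / 4 = ε / 2 by ring] at t
    obtain ⟨w0, hw0⟩ := auxTail_lt hε t
    have hK0 : 0 < K := by linarith
    obtain ⟨ρ, hρ0, hρ1, hρ⟩ : ∃ ρ : ℝ, 0 < ρ ∧ ρ ≤ 1 ∧
        ((L - 2 + 1 : ℕ) : ℝ) * ρ * (2 * K) ^ (L - 2 + 1) ≤ auxc L / 2 := by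
      set q := ((L - 2 + 1 : ℕ) : ℝ) * (2 * K) ^ (L - 2 + 1) with hq
      have hq0 : 0 < q := by positivity
      refine ⟨min 1 (auxc L / 2 / q), by positivity, min_le_left _ _, ?_⟩
      have := min_le_right 1 (auxc L / 2 / q)
      rw [le_div_iff₀ hq0] at this
      refine le_trans (le_of_eq ?_) this
      rw [hq]; ring
    have hM2p : 0 < (ρ * K)⁻¹ := by positivity
    refine ⟨max (2 * K) (ρ * K)⁻¹, w0, fun w hw => ?_⟩
    obtain ⟨hw1, hS⟩ := hw0 w hw
    have hs1 := auxS_one γ hγ2 w hw1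
    have hs0 := auxS_pos γ w hw1
    rw [show (w : ℝ) ^ ((1 - γ) / 2) = auxS γ w from rfl]
    have hsad : ∀ θ : DLNParams n0 nL w L, (∀ x : Fin n0 → ℝ,
        (auxc L * auxS γ w ^ (L - 2 + 1)) ^ 2 * ∑ j, x j ^ 2 ≤
          ∑ i, ((auxH θ (L - 2)).mulVec x i) ^ 2) → DLNIsSaddle C (auxZero θ) := by
      intro θ hθ
      apply auxZero_saddle C hconv hdiff h0
      intro hz
      have h1 := hθ (Pi.single ⟨0, hn0⟩ 1)
      rw [hz] at h1
      simp only [Matrix.zero_mulVec, Pi.zero_apply, Pi.single_apply, ite_pow, one_pow, ne_eq,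
        OfNat.ofNat_ne_zero, not_false_eq_true, zero_pow, Finset.sum_ite_eq', Finset.mem_univ,
        if_true, mul_one, Finset.sum_const_zero] at h1
      have : 0 < (auxc L * auxS γ w ^ (L - 2 + 1)) ^ 2 := by positivity
      linarith
    constructor
    · apply hS
      rintro θ hθ ⟨a1, a2⟩
      have b3 := (aux_ds_le C θ _ (hsad θ a2)).trans (auxZero_dist θ _ (by positivity) a1)
      have b4 : 2 * K * auxS γ w ≤ max (2 * K) (ρ * K)⁻¹ * auxS γ w := by
        gcongr; exact le_max_left _ _
      rw [mul_assoc] at b4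
      exact absurd hθ (not_lt.2 (b3.trans b4))
    · apply hS
      rintro θ hθ ⟨a1, a2⟩
      have b3 := aux_le_ds C θ ⟨_, hsad θ a2⟩ _ _ hM2p
        (fun θ'' h'' => aux_det_ds_low C hconv hdiff θ θ'' K (auxS γ w) (auxc L) ρ hK hs1 hc hρ0
          hρ1 hρ a1 a2 h'')
      have b4 : (ρ * K)⁻¹ * dlnDs C θ ≤ max (2 * K) (ρ * K)⁻¹ * dlnDs C θ :=
        mul_le_mul_of_nonneg_right (le_max_right _ _) (aux_ds_nonneg C θ)
      exact absurd hθ (not_lt.2 (b3.trans b4))
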